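/- arXiv:1503.04353 — 7 statements merged into one kernel-verified Lean document; each statement's English description precedes it below -/
import Mathlib

section
/- There exists a probability measure N on ℝ whose support is exactly the interval [0, e] and whose Stieltjes transform f(z) = ∫_ℝ N(dλ)/(λ − z) satisfies (1 + f(z))·Log(1 + f(z)) = −1/z for all z ∈ ℂ∖[0,∞), where Log is the principal branch of the logarithm. -/
open MeasureTheory Complex Filter

/-- The Stieltjes transform of a measure on `ℝ`. -/
noncomputable def stieltjesTransform (N : Measure ℝ) (z : ℂ) : ℂ :=
  ∫ l : ℝ, ((l : ℂ) - z)⁻¹ ∂N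

/-- The cut plane `ℂ ∖ [0,∞)`. -/
def cutPlane : Set ℂ := {z : ℂ | z.im ≠ 0 ∨ z.re < 0}

open scoped Topology

/-- The function `v ↦ (sin v / v) exp (v cot v)` on `(0, π)`. -/
noncomputable def sincExpCot (v : ℝ) : ℝ :=
  Real.sin v / v * Real.exp (v * (Real.cos v / Real.sin v))

lemma integral_circle_exp_pow (k : ℕ) :
    ∫ v in (0 : ℝ)..(2 * Real.pi), cexp (k * (cexp (v * I) - v * I)) =
      2 * Real.pi * (k : ℂ) ^ k / k.factorial := by
  have h := DifferentiableOn.circleIntegral_one_div_sub_center_pow_smul (c := 0)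
    (f := fun w : ℂ => cexp (k * w)) one_pos k (by fun_prop)
  have hd : iteratedDeriv k (fun w : ℂ => cexp (k * w)) 0 = (k : ℂ) ^ k := by
    rw [iteratedDeriv_cexp_const_mul]
    simp
  rw [hd, circleIntegral] at h
  have hi : ∀ v : ℝ, deriv (circleMap 0 1) v • (1 / (circleMap 0 1 v - 0) ^ (k + 1)) •
      cexp (k * circleMap 0 1 v) = I * cexp (k * (cexp (v * I) - v * I)) := by
    intro v
    have : cexp (v * I) ≠ 0 := Complex.exp_ne_zero _
    simp only [deriv_circleMap, circleMap, ofReal_one, one_mul, zero_add, smul_eq_mul, sub_zero]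
    rw [mul_sub, Complex.exp_sub, Complex.exp_nat_mul (v * I)]
    field_simp
    rw [pow_succ']
  simp_rw [hi] at h
  rw [intervalIntegral.integral_const_mul] at h
  apply mul_left_cancel₀ I_ne_zero
  rw [h, smul_eq_mul]
  ring

lemma integral_half_circle_exp_pow (k : ℕ) :
    ∫ v in (0 : ℝ)..Real.pi, (cexp (k * (cexp (v * I) - v * I))).re =
      Real.pi * ((k : ℝ) ^ k / k.factorial) := by
  set g : ℝ → ℂ := fun v => cexp (k * (cexp (v * I) - v * I)) with hg
  have hc : Continuous g := by fun_prop
  have hcr : Continuous fun v => (g v).re := by fun_prop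
  have hsymm : ∀ v, (g (2 * Real.pi - v)).re = (g v).re := by
    intro v
    have : g (2 * Real.pi - v) = (starRingEnd ℂ) (g v) := by
      simp only [hg, ← Complex.exp_conj, map_mul, map_sub, conj_I, conj_ofReal, Complex.conj_natCast]
      have e1 : cexp (((2 * Real.pi - v : ℝ) : ℂ) * I) = cexp (v * -I) := by
        rw [show (((2 * Real.pi - v : ℝ) : ℂ) * I) = v * -I + 2 * Real.pi * I by push_cast; ring]
        exact Complex.exp_periodic _
      rw [e1, show (k : ℂ) * (cexp (v * -I) - ((2 * Real.pi - v : ℝ) : ℂ) * I) =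
        k * (cexp (v * -I) - v * -I) - k * (2 * Real.pi * I) by push_cast; ring]
      exact Complex.exp_periodic.sub_nat_mul_eq k
    rw [this, conj_re]
  have h := congrArg Complex.re (integral_circle_exp_pow k)
  have hre : (∫ v in (0 : ℝ)..(2 * Real.pi), g v).re = ∫ v in (0 : ℝ)..(2 * Real.pi), (g v).re :=
    (Complex.reCLM.intervalIntegral_comp_comm (hc.intervalIntegrable _ _)).symm
  rw [hre, ← intervalIntegral.integral_add_adjacent_intervals (b := Real.pi)
    (hcr.intervalIntegrable _ _) (hcr.intervalIntegrable _ _)] at h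
  have hflip : ∫ v in Real.pi..(2 * Real.pi), (g v).re = ∫ v in (0 : ℝ)..Real.pi, (g v).re := by
    have := intervalIntegral.integral_comp_sub_left (a := 0) (b := Real.pi) (fun v => (g v).re)
      (2 * Real.pi)
    rw [show 2 * Real.pi - Real.pi = Real.pi by ring, sub_zero] at this
    rw [← this]
    simp_rw [hsymm]
  have hval : (2 * Real.pi * (k : ℂ) ^ k / k.factorial).re
      = 2 * (Real.pi * ((k : ℝ) ^ k / k.factorial)) := by
    rw [← ofReal_re (2 * (Real.pi * ((k : ℝ) ^ k / k.factorial)))]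
    congr 1
    push_cast
    ring
  rw [hflip, hval] at h
  linarith

lemma sincExpCot_pos {v : ℝ} (hv : v ∈ Set.Ioo 0 Real.pi) : 0 < sincExpCot v :=
  mul_pos (div_pos (Real.sin_pos_of_mem_Ioo hv) hv.1) (Real.exp_pos _)

lemma mul_cos_le_sin {v : ℝ} (hv : v ∈ Set.Icc 0 Real.pi) : v * Real.cos v ≤ Real.sin v := by
  have hm : MonotoneOn (fun v => Real.sin v - v * Real.cos v) (Set.Icc 0 Real.pi) := by
    apply monotoneOn_of_deriv_nonneg (convex_Icc _ _) (by fun_prop) (by fun_prop)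
    intro x hx
    rw [interior_Icc] at hx
    have hd : HasDerivAt (fun v => Real.sin v - v * Real.cos v)
        (Real.cos x - (1 * Real.cos x + x * -Real.sin x)) x :=
      (Real.hasDerivAt_sin x).sub ((hasDerivAt_id x).mul (Real.hasDerivAt_cos x))
    rw [hd.deriv]
    nlinarith [mul_pos hx.1 (Real.sin_pos_of_mem_Ioo hx)]
  have := hm (Set.left_mem_Icc.2 Real.pi_pos.le) hv hv.1
  simp at this
  linarith

lemma sincExpCot_le {v : ℝ} (hv : v ∈ Set.Ioo 0 Real.pi) : sincExpCot v ≤ Real.exp 1 := by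
  have hs := Real.sin_pos_of_mem_Ioo hv
  have h1 : Real.sin v / v ≤ 1 := (div_le_one hv.1).2 (Real.sin_le hv.1.le)
  have h2 : v * (Real.cos v / Real.sin v) ≤ 1 := by
    rw [← mul_div_assoc, div_le_one hs]
    exact mul_cos_le_sin ⟨hv.1.le, hv.2.le⟩
  calc sincExpCot v ≤ 1 * Real.exp 1 := by
        unfold sincExpCot
        gcongr
    _ = _ := one_mul _

@[fun_prop]
lemma measurable_sincExpCot : Measurable sincExpCot := by
  unfold sincExpCot
  fun_prop

lemma continuousOn_sincExpCot : ContinuousOn sincExpCot (Set.Ioo 0 Real.pi) := by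
  intro v hv
  have h0 := hv.1.ne'
  have h1 := (Real.sin_pos_of_mem_Ioo hv).ne'
  unfold sincExpCot
  apply ContinuousAt.continuousWithinAt
  fun_prop (disch := assumption)

lemma tendsto_sin_div_nhdsGT_zero :
    Tendsto (fun v : ℝ => Real.sin v / v) (𝓝[>] 0) (𝓝 1) := by
  have h := (Real.hasDerivAt_sin 0).tendsto_slope_zero_right
  simp only [zero_add, Real.sin_zero, sub_zero, Real.cos_zero, smul_eq_mul] at h
  exact h.congr fun v => by rw [div_eq_inv_mul]

lemma tendsto_sincExpCot_zero : Tendsto sincExpCot (𝓝[>] 0) (𝓝 (Real.exp 1)) := by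
  have hc : Tendsto Real.cos (𝓝[>] 0) (𝓝 1) := by
    simpa using (Real.continuous_cos.tendsto 0).mono_left nhdsWithin_le_nhds
  have h := tendsto_sin_div_nhdsGT_zero.mul
    ((Real.continuous_exp.tendsto _).comp (hc.div tendsto_sin_div_nhdsGT_zero one_ne_zero))
  simp only [div_one, one_mul] at h
  refine h.congr fun v => ?_
  simp only [sincExpCot, Function.comp, Pi.div_apply]
  congr 2
  rw [div_div_eq_mul_div]
  ring

/-- The curve in the logarithmic coordinate `s`, along which `exp s - s` is real. -/
noncomputable def realCurve (v : ℝ) : ℂ := (Real.log (v / Real.sin v) : ℂ) + v * I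

lemma exp_realCurve_sub {v : ℝ} (hv : v ∈ Set.Ioo 0 Real.pi) (k : ℕ) :
    cexp (k * (cexp (realCurve v) - realCurve v)) = ((sincExpCot v ^ k : ℝ) : ℂ) := by
  have h0 := hv.1
  have h1 := Real.sin_pos_of_mem_Ioo hv
  have h1' : (Real.sin v : ℂ) ≠ 0 := by exact_mod_cast h1.ne'
  have e1 : cexp (realCurve v) - realCurve v =
      ((v * (Real.cos v / Real.sin v) - Real.log (v / Real.sin v) : ℝ) : ℂ) := by
    unfold realCurve
    rw [Complex.exp_add, Complex.exp_mul_I, ← ofReal_exp, Real.exp_log (by positivity),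
      ← ofReal_cos, ← ofReal_sin]
    push_cast
    push_cast at h1'
    field_simp
    ring
  rw [e1, Complex.exp_nat_mul, ← ofReal_exp, Real.exp_sub, Real.exp_log (by positivity)]
  unfold sincExpCot
  push_cast
  congr 1
  rw [div_div_eq_mul_div]
  ring

lemma hasDerivAt_realCurve {v : ℝ} (hv : v ∈ Set.Ioo 0 Real.pi) :
    ∃ r : ℝ, HasDerivAt realCurve (r + I) v := by
  have h0 := hv.1
  have h1 := Real.sin_pos_of_mem_Ioo hv
  have hd : DifferentiableAt ℝ (fun v => Real.log (v / Real.sin v)) v := by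
    fun_prop (disch := positivity)
  refine ⟨_, hd.hasDerivAt.ofReal_comp.add ?_⟩
  simpa using (hasDerivAt_id v).ofReal_comp.mul_const I

lemma tendsto_realCurve_zero : Tendsto realCurve (𝓝[>] 0) (𝓝 0) := by
  have h1 : Tendsto (fun v : ℝ => Real.log (v / Real.sin v)) (𝓝[>] 0) (𝓝 0) := by
    have := (tendsto_sin_div_nhdsGT_zero.inv₀ one_ne_zero).log (by norm_num)
    simpa using this
  have h2 : Tendsto (fun v : ℝ => (v : ℂ) * I) (𝓝[>] 0) (𝓝 0) := by
    have : Continuous fun v : ℝ => (v : ℂ) * I := by fun_prop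
    simpa using (this.tendsto 0).mono_left nhdsWithin_le_nhds
  simpa [realCurve, Function.comp_def] using! ((continuous_ofReal.tendsto _).comp h1).add h2

lemma integral_sincExpCot_pow (k : ℕ) :
    ∫ v in (0 : ℝ)..Real.pi, sincExpCot v ^ k = Real.pi * ((k : ℝ) ^ k / k.factorial) := by
  obtain ⟨Φ, hΦ⟩ := Differentiable.isExactOn_univ
    (f := fun s : ℂ => cexp (k * (cexp s - s))) (by fun_prop)
  replace hΦ : ∀ s, HasDerivAt Φ (cexp (k * (cexp s - s))) s := fun s => hΦ s (Set.mem_univ s)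
  have hΦc : Continuous Φ := continuous_iff_continuousAt.2 fun s => (hΦ s).continuousAt
  -- the increment of `Im Φ` along `[0, iπ]`
  have hvert : (Φ (Real.pi * I)).im - (Φ 0).im = Real.pi * ((k : ℝ) ^ k / k.factorial) := by
    rw [← integral_half_circle_exp_pow]
    have hd : ∀ v : ℝ, HasDerivAt (fun v : ℝ => (Φ (v * I)).im)
        (cexp (k * (cexp (v * I) - v * I))).re v := by
      intro v
      have hl : HasDerivAt (fun v : ℝ => (v : ℂ) * I) I v := by
        simpa using (hasDerivAt_id v).ofReal_comp.mul_const I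
      have := Complex.imCLM.hasFDerivAt.comp_hasDerivAt v ((hΦ (v * I)).comp v hl)
      simpa [Function.comp_def] using this
    rw [intervalIntegral.integral_eq_sub_of_hasDerivAt (fun v _ => hd v)
      (Continuous.intervalIntegrable (by fun_prop) _ _)]
    simp
  -- `Im Φ` is constant on the line `Im s = π`
  have hhor : ∀ t : ℝ, (Φ (t + Real.pi * I)).im = (Φ (Real.pi * I)).im := by
    have hd : ∀ t : ℝ, HasDerivAt (fun t : ℝ => (Φ (t + Real.pi * I)).im) 0 t := by
      intro t
      have hl : HasDerivAt (fun t : ℝ => (t : ℂ) + Real.pi * I) 1 t := by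
        simpa using (hasDerivAt_id t).ofReal_comp.add_const (Real.pi * I)
      have := Complex.imCLM.hasFDerivAt.comp_hasDerivAt t ((hΦ (t + Real.pi * I)).comp t hl)
      refine this.congr_deriv ?_
      have e : cexp (k * (cexp (t + Real.pi * I) - (t + Real.pi * I))) =
          ((Real.exp (k * (-Real.exp t - t)) * (-1) ^ k : ℝ) : ℂ) := by
        rw [Complex.exp_add, Complex.exp_pi_mul_I, show (k : ℂ) * (cexp t * -1 -
          (t + Real.pi * I)) = k * (-cexp t - t) - k * (Real.pi * I) by ring, Complex.exp_sub,
          Complex.exp_nat_mul (Real.pi * I), Complex.exp_pi_mul_I]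
        push_cast
        rw [div_eq_mul_inv, ← inv_pow]
        norm_num
      rw [e, mul_one, imCLM_apply, ofReal_im]
    intro t
    have := is_const_of_deriv_eq_zero (fun t => (hd t).differentiableAt)
      (fun t => (hd t).deriv) t 0
    simpa using this
  have hlip : ∀ v ∈ Set.Ico (Real.pi / 2) Real.pi,
      ‖Φ (realCurve v) - Φ (Real.log (v / Real.sin v) + Real.pi * I)‖ ≤ Real.pi - v := by
    intro v hv
    have hpi := Real.pi_pos
    have hv0 : 0 < v := by linarith [hv.1]
    have hs := Real.sin_pos_of_mem_Ioo ⟨hv0, hv.2⟩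
    have hlog : 0 ≤ Real.log (v / Real.sin v) :=
      Real.log_nonneg ((one_le_div hs).2 (Real.sin_le hv0.le))
    have hS : Convex ℝ (Set.Ici (0 : ℝ) ×ℂ Set.Icc (Real.pi / 2) Real.pi) :=
      ((convex_Ici (0 : ℝ)).linear_preimage reLm).inter
        ((convex_Icc (Real.pi / 2) Real.pi).linear_preimage imLm)
    have := hS.norm_image_sub_le_of_norm_hasDerivWithin_le (C := 1)
      (fun s _ => (hΦ s).hasDerivWithinAt) (fun s hs' => ?_)
      (x := Real.log (v / Real.sin v) + Real.pi * I) (y := realCurve v) ?_ ?_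
    · refine this.trans (le_of_eq ?_)
      have : realCurve v - (Real.log (v / Real.sin v) + Real.pi * I) =
          ((v - Real.pi : ℝ) : ℂ) * I := by
        unfold realCurve
        push_cast
        ring
      rw [this, norm_mul, norm_I, norm_real, Real.norm_eq_abs, abs_of_neg (by linarith [hv.2])]
      ring
    · rw [Complex.mem_reProdIm] at hs'
      have hcos : Real.cos s.im ≤ 0 :=
        Real.cos_nonpos_of_pi_div_two_le_of_le hs'.2.1 (by linarith [hs'.2.2])
      have hre : 0 ≤ s.re := hs'.1
      rw [Complex.norm_exp, Real.exp_le_one_iff]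
      simp only [mul_re, natCast_re, natCast_im, zero_mul, sub_zero, sub_re, exp_re]
      have := mul_nonpos_of_nonneg_of_nonpos (Real.exp_pos s.re).le hcos
      exact mul_nonpos_of_nonneg_of_nonpos (Nat.cast_nonneg k) (by linarith)
    · rw [Complex.mem_reProdIm]
      simp only [add_re, ofReal_re, mul_re, I_re, mul_zero, ofReal_im, I_im, mul_one, sub_self,
        add_zero, add_im, mul_im, zero_add, Set.mem_Ici, Set.mem_Icc]
      exact ⟨hlog, by linarith, le_rfl⟩
    · rw [Complex.mem_reProdIm]
      simp only [realCurve, add_re, ofReal_re, mul_re, I_re, mul_zero, ofReal_im, I_im, mul_one,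
        sub_self, add_zero, add_im, mul_im, zero_add, Set.mem_Ici, Set.mem_Icc]
      exact ⟨hlog, hv.1, hv.2.le⟩
  rw [← hvert]
  refine intervalIntegral.integral_eq_sub_of_hasDerivAt_of_tendsto
    (f := fun v => (Φ (realCurve v)).im) Real.pi_pos (fun v hv => ?_) ?_ ?_ ?_
  · obtain ⟨r, hr⟩ := hasDerivAt_realCurve hv
    have := Complex.imCLM.hasFDerivAt.comp_hasDerivAt v ((hΦ (realCurve v)).comp v hr)
    refine this.congr_deriv ?_
    rw [exp_realCurve_sub hv, imCLM_apply, im_ofReal_mul]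
    simp
  · rw [intervalIntegrable_iff_integrableOn_Ioo_of_le Real.pi_pos.le]
    refine IntegrableOn.of_bound (C := Real.exp 1 ^ k) (by simp)
      (by fun_prop) ((ae_restrict_iff' measurableSet_Ioo).2 (ae_of_all _ fun v hv => ?_))
    have h0 := sincExpCot_pos hv
    rw [norm_pow, Real.norm_eq_abs, abs_of_pos h0]
    exact pow_le_pow_left₀ h0.le (sincExpCot_le hv) k
  · exact ((Complex.continuous_im.comp hΦc).tendsto _).comp tendsto_realCurve_zero
  · rw [tendsto_iff_norm_sub_tendsto_zero]
    have hlim : Tendsto (fun v => Real.pi - v) (𝓝[<] Real.pi) (𝓝 0) := by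
      have : Continuous fun v : ℝ => Real.pi - v := by fun_prop
      simpa using (this.tendsto Real.pi).mono_left nhdsWithin_le_nhds
    refine tendsto_of_tendsto_of_tendsto_of_le_of_le' tendsto_const_nhds hlim
      (Eventually.of_forall fun _ => norm_nonneg _) ?_
    filter_upwards [Ico_mem_nhdsLT (half_lt_self Real.pi_pos)] with v hv
    rw [← hhor (Real.log (v / Real.sin v)), ← sub_im]
    exact (Complex.abs_im_le_norm _).trans (hlip v hv)

lemma pow_div_factorial_le_exp (k : ℕ) : (k : ℝ) ^ k / k.factorial ≤ Real.exp 1 ^ k := by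
  rw [← Real.exp_nat_mul, mul_one]
  exact Real.pow_div_factorial_le_exp _ (Nat.cast_nonneg k) k

lemma sum_range_choose_shifted_pow (n : ℕ) :
    ∑ m ∈ Finset.range (n + 1),
      (-1 : ℝ) ^ m * (n + 1).choose (m + 1) * (m : ℝ) ^ n = (-1) ^ n := by
  have h := congrFun (fwdDiff_iter_pow_eq_zero_of_lt (R := ℝ) (Nat.lt_succ_self n)) (-1)
  rw [fwdDiff_iter_eq_sum_shift, Finset.sum_range_succ'] at h
  have h2 : ∀ m ∈ Finset.range (n + 1),
      ((-1 : ℤ) ^ (n + 1 - (m + 1)) * (n + 1).choose (m + 1)) • ((-1 : ℝ) + (m + 1) • (1 : ℝ)) ^ n =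
      (-1) ^ n * ((-1 : ℝ) ^ m * (n + 1).choose (m + 1) * (m : ℝ) ^ n) := by
    intro m hm
    have hm' : m ≤ n := by simpa [Nat.lt_succ_iff] using hm
    obtain ⟨j, rfl⟩ := Nat.exists_eq_add_of_le hm'
    have : (-1 : ℝ) ^ (m + j) * (-1) ^ m = (-1) ^ j := by
      rw [← pow_add, show m + j + m = j + 2 * m by ring, pow_add, pow_mul]
      norm_num
    simp only [Nat.add_sub_add_right, Nat.add_sub_cancel_left, zsmul_eq_mul, nsmul_eq_mul]
    push_cast
    rw [← mul_assoc, ← mul_assoc, this]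
    ring
  simp only [Nat.succ_eq_add_one, Pi.zero_apply] at h
  rw [Finset.sum_congr rfl h2, ← Finset.mul_sum] at h
  have hs : (-1 : ℝ) ^ n * (-1) ^ n = 1 := by
    rw [← mul_pow]
    norm_num
  simp only [Nat.sub_zero, Nat.choose_zero_right, Nat.cast_one, mul_one, zsmul_eq_mul,
    zero_smul, add_zero] at h
  push_cast at h
  rw [pow_succ] at h
  set S := ∑ m ∈ Finset.range (n + 1), (-1 : ℝ) ^ m * (n + 1).choose (m + 1) * (m : ℝ) ^ n
  linear_combination ((-1 : ℝ) ^ n) * h + ((-1 : ℝ) ^ n - S) * hs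

lemma hasSum_moments {w : ℝ} (hw0 : 0 ≤ w) (hw : w * Real.exp w * Real.exp 1 < 1) :
    HasSum (fun k : ℕ => (w * Real.exp w) *
      ((k : ℝ) ^ k / (k + 1).factorial * (-(w * Real.exp w)) ^ k)) (Real.exp w - 1) := by
  set a : ℕ × ℕ → ℝ := fun p => (-1) ^ p.1 * ((p.1 : ℝ) ^ p.1 / (p.1 + 1).factorial) * w ^ (p.1 + 1)
    * ((p.1 * w) ^ p.2 / p.2.factorial) with ha
  have hrow : ∀ k : ℕ, HasSum (fun j => a (k, j))
      ((-1) ^ k * ((k : ℝ) ^ k / (k + 1).factorial) * w ^ (k + 1) * Real.exp (k * w)) := by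
    intro k
    have := NormedSpace.expSeries_div_hasSum_exp (𝔸 := ℝ) (k * w)
    rw [← Real.exp_eq_exp_ℝ] at this
    exact this.mul_left _
  have hnorm : ∀ k j : ℕ, ‖a (k, j)‖ = (k : ℝ) ^ k / (k + 1).factorial * w ^ (k + 1)
      * ((k * w) ^ j / j.factorial) := by
    intro k j
    simp only [ha, norm_mul, norm_pow, norm_neg, norm_one, one_pow, one_mul]
    rw [Real.norm_of_nonneg (by positivity), Real.norm_of_nonneg (by positivity),
      Real.norm_of_nonneg (by positivity)]
  have hrown : ∀ k : ℕ, HasSum (fun j => ‖a (k, j)‖)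
      (((k : ℝ) ^ k / (k + 1).factorial) * w ^ (k + 1) * Real.exp (k * w)) := by
    intro k
    have := NormedSpace.expSeries_div_hasSum_exp (𝔸 := ℝ) (k * w)
    rw [← Real.exp_eq_exp_ℝ] at this
    simp_rw [hnorm]
    exact this.mul_left _
  have hsum : Summable a := by
    apply Summable.of_norm
    rw [summable_prod_of_nonneg (fun _ => norm_nonneg _)]
    refine ⟨fun k => (hrown k).summable, ?_⟩
    simp_rw [(hrown _).tsum_eq]
    refine Summable.of_nonneg_of_le (fun k => by positivity) (fun k => ?_)
      ((summable_geometric_of_lt_one (by positivity) hw).mul_left w)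
    calc (k : ℝ) ^ k / (k + 1).factorial * w ^ (k + 1) * Real.exp (k * w)
        ≤ Real.exp 1 ^ k * w ^ (k + 1) * Real.exp (k * w) := by
          gcongr
          refine le_trans ?_ (pow_div_factorial_le_exp k)
          gcongr
          omega
      _ = w * (w * Real.exp w * Real.exp 1) ^ k := by
          rw [Real.exp_nat_mul]
          ring
  have hdiag : ∀ n : ℕ, ∑ p ∈ Finset.HasAntidiagonal.antidiagonal n, a p =
      -((-w) ^ (n + 1) / (n + 1).factorial) := by
    intro n
    rw [Finset.Nat.sum_antidiagonal_eq_sum_range_succ_mk]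
    have ht : ∀ m ∈ Finset.range n.succ, a (m, n - m) = w ^ (n + 1) / (n + 1).factorial *
        ((-1 : ℝ) ^ m * (n + 1).choose (m + 1) * (m : ℝ) ^ n) := by
      intro m hm
      have hm' : m ≤ n := by simpa [Nat.lt_succ_iff] using hm
      obtain ⟨j, rfl⟩ := Nat.exists_eq_add_of_le hm'
      have hch := Nat.choose_mul_factorial_mul_factorial (show m + 1 ≤ m + j + 1 by omega)
      rw [show m + j + 1 - (m + 1) = j by omega] at hch
      have hch' : ((m + j + 1).choose (m + 1) : ℝ) * (m + 1).factorial * j.factorial =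
        (m + j + 1).factorial := by exact_mod_cast hch
      simp only [ha, Nat.add_sub_cancel_left]
      rw [← hch']
      have h1 : ((m + j + 1).choose (m + 1) : ℝ) ≠ 0 := by
        exact_mod_cast (Nat.choose_pos (by omega)).ne'
      field_simp
      ring
    rw [Finset.sum_congr rfl ht, ← Finset.mul_sum, sum_range_choose_shifted_pow, neg_pow w]
    ring
  have h1 : HasSum (fun k : ℕ => (-1) ^ k * ((k : ℝ) ^ k / (k + 1).factorial) * w ^ (k + 1)
      * Real.exp (k * w)) (∑' p, a p) := hsum.hasSum.prod_fiberwise hrow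
  have h2 : HasSum (fun n : ℕ => -((-w) ^ (n + 1) / (n + 1).factorial)) (∑' p, a p) := by
    have := (Finset.HasAntidiagonal.sigmaAntidiagonalEquivProd.hasSum_iff.2 hsum.hasSum).sigma
      (fun n => hasSum_fintype _)
    convert this using 2 with n
    rw [← hdiag, ← Finset.sum_coe_sort]
    rfl
  have h3 : HasSum (fun n : ℕ => -((-w) ^ (n + 1) / (n + 1).factorial)) (1 - Real.exp (-w)) := by
    have := NormedSpace.expSeries_div_hasSum_exp (𝔸 := ℝ) (-w)
    rw [← Real.exp_eq_exp_ℝ, ← hasSum_nat_add_iff' 1] at this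
    simpa using this.neg
  rw [h2.unique h3] at h1
  have h4 := h1.mul_left (Real.exp w)
  have hv : Real.exp w * (1 - Real.exp (-w)) = Real.exp w - 1 := by
    rw [mul_sub, ← Real.exp_add]
    simp
  rw [hv] at h4
  refine Eq.subst (motive := fun f => HasSum f _) (funext fun k => ?_) h4
  rw [Real.exp_nat_mul, neg_pow]
  ring

lemma isPreconnected_cutPlane : IsPreconnected cutPlane := by
  have h : cutPlane = (fun z : ℂ => -z) '' slitPlane := by
    ext z
    simp [cutPlane, mem_slitPlane_iff, or_comm]
  rw [h]
  have hp := starConvex_one_slitPlane.isPathConnected one_mem_slitPlane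
  exact hp.isConnected.isPreconnected.image _ (by fun_prop)

lemma isOpen_cutPlane : IsOpen cutPlane := by
  have h : cutPlane = (fun z : ℂ => -z) ⁻¹' slitPlane := by
    ext z
    simp [cutPlane, mem_slitPlane_iff, or_comm]
  rw [h]
  exact isOpen_slitPlane.preimage (by fun_prop)

section Stieltjes

variable {N : Measure ℝ}

lemma stieltjesTransform_eq_resolventTransform :
    stieltjesTransform N = resolventTransform N := by
  funext z
  simp [stieltjesTransform, resolventTransform_apply, resolvent]

lemma notMem_support_of_mem_cutPlane (hN : ∀ᵐ l ∂N, 0 ≤ l) {z : ℂ} (hz : z ∈ cutPlane) :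
    z ∉ algebraMap ℝ ℂ '' N.support := by
  rintro ⟨l, hl, rfl⟩
  have : 0 ≤ l := Measure.support_subset_of_isClosed isClosed_Ici hN hl
  rcases hz with hz | hz
  · simp at hz
  · simp at hz
    linarith

variable [IsProbabilityMeasure N]

lemma integrable_inv_sub (hN : ∀ᵐ l ∂N, 0 ≤ l) {z : ℂ} (hz : z ∈ cutPlane) :
    Integrable (fun l : ℝ => ((l : ℂ) - z)⁻¹) N := by
  refine (integrable_resolvent (notMem_support_of_mem_cutPlane hN hz)).congr (ae_of_all _ ?_)
  intro l
  simp [resolvent]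

lemma analyticOnNhd_stieltjesTransform (hN : ∀ᵐ l ∂N, 0 ≤ l) :
    AnalyticOnNhd ℂ (stieltjesTransform N) cutPlane := by
  apply DifferentiableOn.analyticOnNhd _ isOpen_cutPlane
  intro z hz
  rw [stieltjesTransform_eq_resolventTransform]
  exact (hasDerivAt_resolventTransform z
    (notMem_support_of_mem_cutPlane hN hz)).differentiableAt.differentiableWithinAt

lemma one_add_stieltjesTransform_mem_slitPlane (hN : ∀ᵐ l ∂N, 0 ≤ l) {z : ℂ}
    (hz : z ∈ cutPlane) : 1 + stieltjesTransform N z ∈ slitPlane := by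
  have hi := integrable_inv_sub hN hz
  rw [mem_slitPlane_iff]
  by_cases him : z.im = 0
  · left
    have hre : z.re < 0 := hz.resolve_left (not_not.2 him)
    have h : (stieltjesTransform N z).re = ∫ l : ℝ, (((l : ℂ) - z)⁻¹).re ∂N :=
      (Complex.reCLM.integral_comp_comm hi).symm
    have h0 : 0 ≤ ∫ l : ℝ, (((l : ℂ) - z)⁻¹).re ∂N := by
      apply integral_nonneg_of_ae
      filter_upwards [hN] with l hl
      rw [Pi.zero_apply, inv_re]
      apply div_nonneg _ (normSq_nonneg _)
      simp only [sub_re, ofReal_re]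
      linarith
    rw [add_re, h, one_re]
    linarith
  · right
    have h : (stieltjesTransform N z).im = ∫ l : ℝ, (((l : ℂ) - z)⁻¹).im ∂N :=
      (Complex.imCLM.integral_comp_comm hi).symm
    have hpos : ∀ l : ℝ, 0 < z.im * (((l : ℂ) - z)⁻¹).im := by
      intro l
      have hne : (l : ℂ) - z ≠ 0 := fun h => him (by simpa using congrArg Complex.im h)
      have := normSq_pos.2 hne
      rw [inv_im]
      simp only [sub_im, ofReal_im, zero_sub, neg_neg]
      rw [← mul_div_assoc]
      exact div_pos (mul_self_pos.2 him) this
    have hint : 0 < ∫ l : ℝ, z.im * (((l : ℂ) - z)⁻¹).im ∂N := by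
      rw [integral_pos_iff_support_of_nonneg (fun l => (hpos l).le) (hi.im.const_mul _)]
      rw [show Function.support (fun l : ℝ => z.im * (((l : ℂ) - z)⁻¹).im) = Set.univ from
        Set.eq_univ_of_forall fun l => (hpos l).ne']
      simp
    rw [integral_const_mul, ← h] at hint
    rw [add_im, one_im, zero_add]
    exact fun h0 => by simp [h0] at hint

lemma hasSum_stieltjesTransform {b q : ℝ} (hN : ∀ᵐ l ∂N, l ∈ Set.Icc 0 b) (hq : 0 < q)
    (hqb : q * b < 1) :
    HasSum (fun k : ℕ => q * ((∫ l, l ^ k ∂N) * (-q) ^ k)) (∫ l, (l - -q⁻¹)⁻¹ ∂N) := by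
  have hb : 0 ≤ b := by
    obtain ⟨l, hl⟩ := hN.exists
    exact hl.1.trans hl.2
  have hgeo : Summable fun k : ℕ => q * (q * b) ^ k :=
    (summable_geometric_of_lt_one (by positivity) hqb).mul_left q
  have h := hasSum_integral_of_dominated_convergence (μ := N)
    (F := fun (k : ℕ) (l : ℝ) => q * (l ^ k * (-q) ^ k)) (f := fun l : ℝ => (l - -q⁻¹)⁻¹)
    (fun k _ => q * (q * b) ^ k) (fun k => by fun_prop) ?_ (ae_of_all _ fun _ => hgeo)
    (integrable_const _) ?_
  · simpa only [integral_const_mul, integral_mul_const] using h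
  · intro k
    filter_upwards [hN] with l hl
    have hl0 := hl.1
    rw [← mul_pow, norm_mul, norm_pow, norm_mul, norm_neg, Real.norm_of_nonneg hq.le,
      Real.norm_of_nonneg hl.1, mul_comm l]
    gcongr
    exact hl.2
  · filter_upwards [hN] with l hl
    have hl0 := hl.1
    have hlt : ‖l * -q‖ < 1 := by
      rw [norm_mul, norm_neg, Real.norm_of_nonneg hq.le, Real.norm_of_nonneg hl.1, mul_comm l]
      exact (mul_le_mul_of_nonneg_left hl.2 hq.le).trans_lt hqb
    have h := (hasSum_geometric_of_norm_lt_one hlt).mul_left q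
    simp_rw [← mul_pow]
    have e : (l - -q⁻¹)⁻¹ = q * (1 - l * -q)⁻¹ := by
      have : 1 - l * -q ≠ 0 := by
        have := mul_nonneg hl.1 hq.le
        linarith
      have h2 : l - -q⁻¹ = (1 - l * -q) / q := by
        field_simp
        ring
      rw [h2, inv_div, div_eq_mul_inv]
    rw [e]
    exact h

lemma stieltjesTransform_of_moments (hN : ∀ᵐ l ∂N, l ∈ Set.Icc 0 (Real.exp 1))
    (hm : ∀ k : ℕ, ∫ l, l ^ k ∂N = (k : ℝ) ^ k / (k + 1).factorial) {w : ℝ} (hw0 : 0 < w)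
    (hw : w * Real.exp w * Real.exp 1 < 1) :
    stieltjesTransform N ((-(w * Real.exp w)⁻¹ : ℝ) : ℂ) = ((Real.exp w - 1 : ℝ) : ℂ) := by
  have h := hasSum_stieltjesTransform hN (q := w * Real.exp w) (by positivity) hw
  simp_rw [hm] at h
  rw [← h.unique (hasSum_moments hw0.le hw), ← integral_complex_ofReal]
  simp [stieltjesTransform]

lemma stieltjesTransform_equation_of_moments (hN : ∀ᵐ l ∂N, l ∈ Set.Icc 0 (Real.exp 1))
    (hm : ∀ k : ℕ, ∫ l, l ^ k ∂N = (k : ℝ) ^ k / (k + 1).factorial) {z : ℂ} (hz : z ∈ cutPlane) :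
    (1 + stieltjesTransform N z) * Complex.log (1 + stieltjesTransform N z) = -z⁻¹ := by
  have hN0 : ∀ᵐ l ∂N, 0 ≤ l := hN.mono fun l hl => hl.1
  have hreal : ∀ x : ℝ, x < -10 → (1 + stieltjesTransform N x) *
      Complex.log (1 + stieltjesTransform N x) = -(x : ℂ)⁻¹ := by
    intro x hx
    set q := -x⁻¹ with hq
    have hq0 : 0 < q := by
      rw [hq, neg_pos, inv_lt_zero]
      linarith
    have hq1 : q < 1 / 10 := by
      rw [hq, ← inv_neg, one_div]
      exact inv_strictAnti₀ (by norm_num) (by linarith)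
    obtain ⟨w, hw, hwq⟩ := intermediate_value_Icc (a := (0 : ℝ)) (b := 1 / 10) (by norm_num)
      (f := fun w => w * Real.exp w) (by fun_prop) (show q ∈ _ by
        have : (1 : ℝ) ≤ Real.exp (1 / 10) := Real.one_le_exp (by norm_num)
        exact ⟨by simpa using hq0.le, by linarith⟩)
    simp only at hwq
    have hw0 : 0 < w := by
      rcases hw.1.eq_or_lt with h | h
      · rw [← h] at hwq
        simp at hwq
        linarith
      · exact h
    have hst := stieltjesTransform_of_moments hN hm hw0 (by
      rw [hwq]
      nlinarith [Real.exp_one_lt_d9, Real.exp_pos 1])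
    have hxq : -(w * Real.exp w)⁻¹ = x := by
      rw [hwq, hq, inv_neg, inv_inv, neg_neg]
    rw [hxq] at hst
    rw [hst, show (1 : ℂ) + ((Real.exp w - 1 : ℝ) : ℂ) = ((Real.exp w : ℝ) : ℂ) by push_cast; ring,
      ← ofReal_log (Real.exp_pos w).le, Real.log_exp, ← ofReal_mul, mul_comm, hwq, hq]
    push_cast
    rfl
  have hf := analyticOnNhd_stieltjesTransform hN0
  have hmem : ((-20 : ℝ) : ℂ) ∈ cutPlane := Or.inr (by norm_num)
  have hf1 : AnalyticOnNhd ℂ (fun z => 1 + stieltjesTransform N z) cutPlane :=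
    analyticOnNhd_const.add hf
  refine AnalyticOnNhd.eqOn_of_preconnected_of_frequently_eq (z₀ := ((-20 : ℝ) : ℂ))
    (hf1.mul (hf1.clog fun z hz => one_add_stieltjesTransform_mem_slitPlane hN0 hz))
    (g := fun z => -z⁻¹) ?_ isPreconnected_cutPlane hmem ?_ hz
  · intro z hz
    refine (analyticAt_inv ?_).neg
    rintro rfl
    simp [cutPlane] at hz
  · have hev : ∀ᶠ x : ℝ in 𝓝[≠] (-20), x < -10 :=
      nhdsWithin_le_nhds (Iio_mem_nhds (by norm_num))
    have ht : Tendsto (fun x : ℝ => (x : ℂ)) (𝓝[≠] (-20)) (𝓝[≠] ((-20 : ℝ) : ℂ)) :=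
      tendsto_nhdsWithin_of_tendsto_nhds_of_eventually_within _
        ((continuous_ofReal.tendsto _).mono_left nhdsWithin_le_nhds)
        (eventually_mem_nhdsWithin.mono fun x hx => by
          simpa only [Set.mem_compl_iff, Set.mem_singleton_iff, ofReal_inj] using hx)
    exact ht.frequently (hev.mono fun x hx => hreal x hx).frequently

end Stieltjes

/-- The uniform distribution on `(0, 1) × (0, π)`. -/
noncomputable def uniformRectangle : Measure (ℝ × ℝ) :=
  (volume.restrict (Set.Ioo 0 1)).prod
    (ENNReal.ofReal Real.pi⁻¹ • volume.restrict (Set.Ioo 0 Real.pi))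

/-- The distribution of `U * sincExpCot V` with `U` uniform on `(0, 1)` and `V` uniform on
`(0, π)`, independent. -/
noncomputable def triangularLaw : Measure ℝ :=
  uniformRectangle.map fun p => p.1 * sincExpCot p.2

instance : IsProbabilityMeasure uniformRectangle := by
  have h1 : IsProbabilityMeasure (volume.restrict (Set.Ioo (0 : ℝ) 1)) := ⟨by simp⟩
  have h2 : IsProbabilityMeasure
      (ENNReal.ofReal Real.pi⁻¹ • volume.restrict (Set.Ioo 0 Real.pi)) := ⟨by
    simp only [Measure.smul_apply, MeasurableSet.univ, Measure.restrict_apply, Set.univ_inter,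
      Real.volume_Ioo, sub_zero, smul_eq_mul]
    rw [← ENNReal.ofReal_mul (inv_nonneg.2 Real.pi_pos.le), inv_mul_cancel₀ Real.pi_ne_zero,
      ENNReal.ofReal_one]⟩
  unfold uniformRectangle
  infer_instance

lemma measurable_mul_sincExpCot : Measurable fun p : ℝ × ℝ => p.1 * sincExpCot p.2 := by
  fun_prop

instance : IsProbabilityMeasure triangularLaw :=
  Measure.isProbabilityMeasure_map measurable_mul_sincExpCot.aemeasurable

lemma uniformRectangle_eq : uniformRectangle =
    ENNReal.ofReal Real.pi⁻¹ • volume.restrict (Set.Ioo 0 1 ×ˢ Set.Ioo 0 Real.pi) := by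
  rw [uniformRectangle, Measure.prod_smul_right, Measure.prod_restrict, Measure.volume_eq_prod]

lemma ae_uniformRectangle :
    ∀ᵐ p ∂uniformRectangle, p ∈ Set.Ioo (0 : ℝ) 1 ×ˢ Set.Ioo 0 Real.pi := by
  rw [uniformRectangle_eq]
  exact Measure.ae_smul_measure
    (ae_restrict_mem (measurableSet_Ioo.prod measurableSet_Ioo)) _

lemma ae_triangularLaw : ∀ᵐ l ∂triangularLaw, l ∈ Set.Icc 0 (Real.exp 1) := by
  refine (ae_map_iff measurable_mul_sincExpCot.aemeasurable measurableSet_Icc).2 ?_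
  filter_upwards [ae_uniformRectangle] with p hp
  have h0 := sincExpCot_pos hp.2
  have h1 := sincExpCot_le hp.2
  have h2 := hp.1.1
  have h3 := hp.1.2
  exact ⟨by positivity, by nlinarith⟩

lemma moment_triangularLaw (k : ℕ) :
    ∫ l, l ^ k ∂triangularLaw = (k : ℝ) ^ k / (k + 1).factorial := by
  rw [triangularLaw, integral_map measurable_mul_sincExpCot.aemeasurable (by fun_prop)]
  simp_rw [mul_pow]
  rw [uniformRectangle, integral_prod_mul (fun t : ℝ => t ^ k) (fun v => sincExpCot v ^ k),
    integral_smul_measure, ← integral_Ioc_eq_integral_Ioo, ← integral_Ioc_eq_integral_Ioo,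
    ← intervalIntegral.integral_of_le zero_le_one, ← intervalIntegral.integral_of_le Real.pi_pos.le,
    integral_sincExpCot_pow, integral_pow, ENNReal.toReal_ofReal (inv_nonneg.2 Real.pi_pos.le),
    Nat.factorial_succ]
  have := Real.pi_ne_zero
  push_cast
  simp only [smul_eq_mul]
  field_simp
  simp

lemma triangularLaw_pos_of_isOpen {s : Set ℝ} (hs : IsOpen s)
    (hne : (s ∩ Set.Ioo 0 (Real.exp 1)).Nonempty) : 0 < triangularLaw s := by
  obtain ⟨y, hys, hy0, hye⟩ := hne
  obtain ⟨v, hyv, hv⟩ := ((tendsto_sincExpCot_zero.eventually (lt_mem_nhds hye)).and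
    (Ioo_mem_nhdsGT Real.pi_pos)).exists
  have hX := sincExpCot_pos hv
  set R : Set (ℝ × ℝ) := Set.Ioo 0 1 ×ˢ Set.Ioo 0 Real.pi with hR
  have hRo : IsOpen R := isOpen_Ioo.prod isOpen_Ioo
  have hc : ContinuousOn (fun p : ℝ × ℝ => p.1 * sincExpCot p.2) R :=
    continuousOn_fst.mul (continuousOn_sincExpCot.comp continuousOn_snd fun p hp => hp.2)
  have hopen := hc.isOpen_inter_preimage hRo hs
  have hmem : (y / sincExpCot v, v) ∈ R ∩ (fun p : ℝ × ℝ => p.1 * sincExpCot p.2) ⁻¹' s := by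
    refine ⟨⟨⟨by positivity, (div_lt_one hX).2 hyv⟩, hv⟩, ?_⟩
    simpa [div_mul_cancel₀ _ hX.ne'] using hys
  have hpos := hopen.measure_pos volume ⟨_, hmem⟩
  rw [triangularLaw, Measure.map_apply measurable_mul_sincExpCot hs.measurableSet,
    uniformRectangle_eq, Measure.smul_apply, smul_eq_mul,
    Measure.restrict_apply (measurable_mul_sincExpCot hs.measurableSet), Set.inter_comm]
  exact ENNReal.mul_pos (by simpa using Real.pi_pos) hpos.ne'

lemma triangularLaw_ball_pos {x r : ℝ} (hx : x ∈ Set.Icc 0 (Real.exp 1)) (hr : 0 < r) :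
    0 < triangularLaw (Metric.ball x r) := by
  apply triangularLaw_pos_of_isOpen Metric.isOpen_ball
  have hcl : x ∈ closure (Set.Ioo 0 (Real.exp 1)) := by
    rwa [closure_Ioo (Real.exp_pos 1).ne]
  exact mem_closure_iff.1 hcl _ Metric.isOpen_ball (Metric.mem_ball_self hr)

/-- Theorem 1.4(ii): there is a probability measure `N` on `ℝ` whose
support is exactly `[0, e]` and whose Stieltjes transform `f` satisfies
`(1 + f(z))·Log(1 + f(z)) = −1/z` on `ℂ∖[0,∞)`. -/
theorem triangular_limit_measure_exists :
    ∃ N : Measure ℝ, IsProbabilityMeasure N ∧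
      -- the support of `N` is exactly `[0, e]`:
      N (Set.Icc 0 (Real.exp 1))ᶜ = 0 ∧
      (∀ x ∈ Set.Icc 0 (Real.exp 1), ∀ r : ℝ, 0 < r → 0 < N (Metric.ball x r)) ∧
      -- the Stieltjes transform satisfies the limiting equation:
      (∀ z ∈ cutPlane,
        (1 + stieltjesTransform N z) * Complex.log (1 + stieltjesTransform N z) = -z⁻¹) :=
  ⟨triangularLaw, inferInstance, ae_triangularLaw, fun _ hx _ hr => triangularLaw_ball_pos hx hr,
    fun _ hz => stieltjesTransform_equation_of_moments ae_triangularLaw moment_triangularLaw hz⟩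
end

section
/- Let N be the probability measure supported on [0,e] whose Stieltjes transform f satisfies (1 + f(z))·Log(1 + f(z)) = −1/z on ℂ∖[0,∞). Then for every integer k ≥ 1 the k-th moment of N equals μ_k = ∫ λ^k N(dλ) = k^k/(k+1)!. -/
open MeasureTheory Complex Filter

/-- An alternating binomial sum obtained from the vanishing of the `(m+1)`-st finite difference of
`x ↦ x ^ m`, with the first term moved to the other side. -/
lemma sum_range_neg_one_pow_mul_choose_succ_mul_pow (m : ℕ) :
    ∑ k ∈ Finset.range (m + 1), (-1 : ℝ) ^ k * ((m + 1).choose (k + 1)) * (k : ℝ) ^ m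
      = (-1) ^ m := by
  have h := congrFun (fwdDiff_iter_pow_eq_zero_of_lt (R := ℝ) (Nat.lt_succ_self m)) (-1)
  rw [fwdDiff_iter_eq_sum_shift, Finset.sum_range_succ'] at h
  have hterm : ∀ k ∈ Finset.range (m + 1),
      ((-1 : ℤ) ^ (m.succ - (k + 1)) * (m.succ.choose (k + 1) : ℤ)) •
        (-1 + (k + 1) • (1 : ℝ)) ^ m
      = (-1) ^ m * ((-1 : ℝ) ^ k * ((m + 1).choose (k + 1)) * (k : ℝ) ^ m) := by
    intro k hk
    have hkm : k ≤ m := Nat.lt_succ_iff.mp (Finset.mem_range.mp hk)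
    have hsign : (-1 : ℝ) ^ (m - k) = (-1) ^ m * (-1) ^ k := by
      obtain ⟨j, rfl⟩ := Nat.exists_eq_add_of_le hkm
      rw [Nat.add_sub_cancel_left, pow_add, mul_right_comm, ← mul_pow]
      simp
    simp only [Nat.succ_eq_add_one, Nat.add_sub_add_right, zsmul_eq_mul, nsmul_eq_mul]
    push_cast
    rw [hsign]
    ring
  rw [Finset.sum_congr rfl hterm, ← Finset.mul_sum] at h
  have hsq : ((-1 : ℝ) ^ m) * (-1) ^ m = 1 := by rw [← mul_pow]; simp
  simp only [Nat.succ_eq_add_one, Pi.zero_apply, zsmul_eq_mul, nsmul_eq_mul] at h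
  push_cast at h
  simp only [Nat.choose_zero_right, Nat.cast_one, pow_succ, zero_mul, add_zero] at h
  linear_combination (-1 : ℝ) ^ m * h +
    (1 * (-1) ^ m - ∑ k ∈ Finset.range (m + 1),
      (-1 : ℝ) ^ k * ((m + 1).choose (k + 1)) * (k : ℝ) ^ m) * hsq

/-- An instance of Abel's binomial identity. -/
lemma sum_range_choose_succ_mul_pow_self (n : ℕ) :
    ∑ k ∈ Finset.range (n + 1),
      (-1 : ℝ) ^ k * ((n + 1).choose (k + 1)) * (k : ℝ) ^ k * ((k : ℝ) + 1) ^ (n - k) = 1 := by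
  have hexpand : ∀ k ∈ Finset.range (n + 1),
      (-1 : ℝ) ^ k * ((n + 1).choose (k + 1)) * (k : ℝ) ^ k * ((k : ℝ) + 1) ^ (n - k)
      = ∑ m ∈ Finset.range (n + 1), ((n + 1).choose (m + 1) : ℝ) *
          ((-1 : ℝ) ^ k * ((m + 1).choose (k + 1)) * (k : ℝ) ^ m) := by
    intro k hk
    have hkn : k ≤ n := Nat.lt_succ_iff.mp (Finset.mem_range.mp hk)
    have hsub : Finset.Ico k (n + 1) ⊆ Finset.range (n + 1) := by
      intro m; simp
    rw [← Finset.sum_subset hsub, Finset.sum_Ico_eq_sum_range, add_pow, Finset.mul_sum,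
      Nat.succ_sub hkn]
    · refine Finset.sum_congr rfl fun i hi => ?_
      have hi' : i ≤ n - k := Nat.lt_succ_iff.mp (Finset.mem_range.mp hi)
      have hch : (n + 1).choose (k + i + 1) * (k + i + 1).choose (k + 1)
          = (n + 1).choose (k + 1) * (n - k).choose i := by
        rw [Nat.choose_mul (by omega)]
        congr 2 <;> omega
      have hch' : ((n + 1).choose (k + i + 1) : ℝ) * ((k + i + 1).choose (k + 1))
          = (n + 1).choose (k + 1) * (n - k).choose i := by exact_mod_cast hch
      rw [one_pow, pow_add]
      linear_combination (-(-1 : ℝ) ^ k * (k : ℝ) ^ k * (k : ℝ) ^ i) * hch'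
    · intro m hm hm'
      have : m < k := by
        simp only [Finset.mem_range, Finset.mem_Ico] at hm hm'; omega
      rw [Nat.choose_eq_zero_of_lt (by omega : m + 1 < k + 1)]
      simp
  rw [Finset.sum_congr rfl hexpand, Finset.sum_comm]
  have hinner : ∀ m ∈ Finset.range (n + 1),
      ∑ k ∈ Finset.range (n + 1), ((n + 1).choose (m + 1) : ℝ) *
          ((-1 : ℝ) ^ k * ((m + 1).choose (k + 1)) * (k : ℝ) ^ m)
      = (-1) ^ m * ((n + 1).choose (m + 1)) := by
    intro m hm
    have hsub : Finset.range (m + 1) ⊆ Finset.range (n + 1) := by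
      intro i hi
      simp only [Finset.mem_range] at *; omega
    rw [← Finset.mul_sum, ← Finset.sum_subset hsub,
      sum_range_neg_one_pow_mul_choose_succ_mul_pow, mul_comm]
    intro k _ hk
    rw [Nat.choose_eq_zero_of_lt (by simpa using hk)]
    simp
  rw [Finset.sum_congr rfl hinner]
  have halt := add_pow (-1 : ℝ) 1 (n + 1)
  rw [Finset.sum_range_succ'] at halt
  simp only [neg_add_cancel, one_pow, mul_one, pow_succ (-1 : ℝ), mul_neg, neg_mul,
    Finset.sum_neg_distrib, Nat.choose_zero_right, Nat.cast_one, pow_zero, zero_pow,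
    ne_eq, Nat.add_eq_zero_iff, one_ne_zero, and_false, not_false_eq_true] at halt
  linarith

lemma pow_self_div_factorial_succ_le_exp_pow (k : ℕ) :
    (k : ℝ) ^ k / ((k + 1).factorial : ℝ) ≤ Real.exp 1 ^ k := by
  rw [← Real.exp_nat_mul, mul_one]
  refine le_trans ?_ (Real.pow_div_factorial_le_exp (k : ℝ) (Nat.cast_nonneg k) k)
  gcongr
  exact Nat.le_succ k

lemma sum_antidiagonal_pow_self_div_factorial (n : ℕ) :
    ∑ p ∈ Finset.HasAntidiagonal.antidiagonal n, (-1 : ℝ) ^ p.1 * ((p.1 : ℝ) ^ p.1 / ((p.1 + 1).factorial : ℝ)) *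
      (((p.1 : ℝ) + 1) ^ p.2 / (p.2.factorial : ℝ)) = 1 / ((n + 1).factorial : ℝ) := by
  rw [Finset.Nat.sum_antidiagonal_eq_sum_range_succ_mk]
  refine Eq.trans ?_ (congrArg (· / ((n + 1).factorial : ℝ)) (sum_range_choose_succ_mul_pow_self n))
  simp only [Finset.sum_div]
  refine Finset.sum_congr rfl fun k hk => ?_
  have hkn : k + 1 ≤ n + 1 := by simpa [Nat.lt_succ_iff] using hk
  rw [Nat.cast_choose ℝ hkn, Nat.add_sub_add_right]
  have := Nat.factorial_ne_zero (n + 1)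
  field_simp

/-- The series `∑ k^k/(k+1)! w^(k+1)` evaluated at `w = -s exp s`. -/
lemma hasSum_pow_self_div_factorial_mul_pow {s : ℝ} (hs : 0 < s)
    (hs' : Real.exp 1 * (s * Real.exp s) < 1) :
    HasSum (fun k : ℕ => (k : ℝ) ^ k / ((k + 1).factorial : ℝ) * (-(s * Real.exp s)) ^ (k + 1))
      (1 - Real.exp s) := by
  set a : ℕ → ℝ := fun k => (k : ℝ) ^ k / ((k + 1).factorial : ℝ)
  have ha : ∀ k, 0 ≤ a k := fun k => by positivity
  set F : ℕ × ℕ → ℝ := fun p =>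
    a p.1 * (-s) ^ (p.1 + 1) * ((((p.1 : ℝ) + 1) * s) ^ p.2 / (p.2.factorial : ℝ))
  have hexp : ∀ x : ℝ, HasSum (fun j : ℕ => x ^ j / (j.factorial : ℝ)) (Real.exp x) := by
    intro x
    rw [Real.exp_eq_exp_ℝ]
    exact NormedSpace.expSeries_div_hasSum_exp x
  have hmul : ∀ k : ℕ, Real.exp (((k : ℝ) + 1) * s) = Real.exp s ^ (k + 1) := by
    intro k
    rw [← Real.exp_nat_mul]
    push_cast
    rfl
  have hF : Summable F := by
    refine Summable.of_norm ?_
    have hnorm : ∀ p, ‖F p‖ =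
        a p.1 * s ^ (p.1 + 1) * ((((p.1 : ℝ) + 1) * s) ^ p.2 / (p.2.factorial : ℝ)) := by
      intro p
      have h0 : 0 ≤ (((p.1 : ℝ) + 1) * s) ^ p.2 / (p.2.factorial : ℝ) := by positivity
      rw [Real.norm_eq_abs, abs_mul, abs_mul, abs_of_nonneg (ha _), abs_of_nonneg h0, abs_pow,
        abs_neg, abs_of_pos hs]
    rw [summable_prod_of_nonneg (fun _ => norm_nonneg _)]
    simp only [hnorm]
    refine ⟨fun k => (hexp _).summable.mul_left _, ?_⟩
    simp only [tsum_mul_left, (hexp _).tsum_eq, hmul]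
    have hgeom : Summable fun k : ℕ => (s * Real.exp s) * (Real.exp 1 * (s * Real.exp s)) ^ k :=
      (summable_geometric_of_lt_one (by positivity) hs').mul_left _
    refine Summable.of_nonneg_of_le (fun k => by have := ha k; positivity) (fun k => ?_) hgeom
    calc a k * s ^ (k + 1) * Real.exp s ^ (k + 1)
        = a k * (s * Real.exp s) ^ (k + 1) := by rw [mul_pow, mul_assoc]
      _ ≤ Real.exp 1 ^ k * (s * Real.exp s) ^ (k + 1) := by
          gcongr
          exact pow_self_div_factorial_succ_le_exp_pow k
      _ = _ := by rw [pow_succ, mul_pow]; ring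
  have hrows : HasSum (fun k : ℕ => a k * (-(s * Real.exp s)) ^ (k + 1)) (∑' p, F p) := by
    have h := hF.hasSum.prod_fiberwise (fun k => (hexp (((k : ℝ) + 1) * s)).mul_left
      (a k * (-s) ^ (k + 1)))
    refine h.congr_fun fun k => ?_
    rw [hmul, mul_assoc, ← mul_pow, neg_mul]
  have hdiag : HasSum (fun n : ℕ => -(s ^ (n + 1) / ((n + 1).factorial : ℝ))) (∑' p, F p) := by
    have h := ((Finset.HasAntidiagonal.sigmaAntidiagonalEquivProd (A := ℕ)).hasSum_iff.mpr
      hF.hasSum).sigma (fun n => hasSum_fintype _)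
    refine h.congr_fun fun n => ?_
    have hn := sum_antidiagonal_pow_self_div_factorial n
    rw [← Finset.sum_coe_sort] at hn
    rw [← mul_one_div, ← hn, Finset.mul_sum, ← Finset.sum_neg_distrib]
    refine Finset.sum_congr rfl fun p _ => ?_
    have hp : p.1.1 + p.1.2 = n := Finset.HasAntidiagonal.mem_antidiagonal.mp p.2
    simp only [F, a, Function.comp, Finset.HasAntidiagonal.sigmaAntidiagonalEquivProd_apply]
    have hpow : s ^ (n + 1) = s ^ (p.1.1 + 1) * s ^ p.1.2 := by
      rw [← pow_add]
      congr 1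
      omega
    rw [hpow, neg_pow s, mul_pow]
    ring
  have hdiag' : HasSum (fun n : ℕ => -(s ^ (n + 1) / ((n + 1).factorial : ℝ)))
      (1 - Real.exp s) := by
    have h := ((hasSum_nat_add_iff' 1).mpr (hexp s)).neg
    simpa using h
  rwa [hdiag.unique hdiag'] at hrows

/-- Two real power series with geometrically bounded coefficients that agree at points
accumulating at the origin have the same coefficients. -/
lemma eq_of_frequently_tsum_mul_pow_eq {a b : ℕ → ℝ} {R : ℝ} (hR : 0 < R)
    (ha : ∀ k, |a k| ≤ R ^ k) (hb : ∀ k, |b k| ≤ R ^ k)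
    (h : ∃ᶠ x in nhdsWithin (0 : ℝ) {0}ᶜ, ∑' k, a k * x ^ k = ∑' k, b k * x ^ k) : a = b := by
  have key : ∀ c : ℕ → ℝ, (∀ k, |c k| ≤ R ^ k) →
      HasFPowerSeriesAt (fun x => ∑' k, c k * x ^ k)
        (FormalMultilinearSeries.ofScalars ℝ c) 0 := by
    intro c hc
    have hr : ((R⁻¹.toNNReal : NNReal) : ENNReal) ≤
        (FormalMultilinearSeries.ofScalars ℝ c).radius := by
      refine FormalMultilinearSeries.le_radius_of_bound _ 1 fun n => ?_
      rw [FormalMultilinearSeries.ofScalars_norm, Real.norm_eq_abs, Real.coe_toNNReal _ (by positivity), inv_pow]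
      exact mul_inv_le_one_of_le₀ (hc n) (by positivity)
    have hpos : 0 < (FormalMultilinearSeries.ofScalars ℝ c).radius :=
      lt_of_lt_of_le (by
        rw [ENNReal.coe_pos]
        exact Real.toNNReal_pos.mpr (inv_pos.mpr hR)) hr
    have hsum := (FormalMultilinearSeries.hasFPowerSeriesOnBall _ hpos).hasFPowerSeriesAt
    convert hsum using 2 with x
    simp [FormalMultilinearSeries.sum, mul_comm]
  have hev := ((key a ha).analyticAt.frequently_eq_iff_eventually_eq (key b hb).analyticAt).mp h
  have hser := (key a ha).eq_formalMultilinearSeries_of_eventually (key b hb) hev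
  exact FormalMultilinearSeries.ofScalars_series_injective ℝ ℝ hser

/-- A measure carried by `[0, r]` has a Stieltjes transform given by the moment series at `1/w`,
for small nonzero `w`. -/
lemma hasSum_moment_mul_pow {N : Measure ℝ} [IsProbabilityMeasure N] {r : ℝ}
    (hN : ∀ᵐ l ∂N, l ∈ Set.Icc 0 r) {w : ℝ} (hw : w ≠ 0) (hrw : r * |w| < 1) (hr : 0 ≤ r) :
    HasSum (fun k : ℕ => (∫ l : ℝ, l ^ k ∂N) * w ^ (k + 1)) (-∫ l : ℝ, (l - w⁻¹)⁻¹ ∂N) := by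
  rw [← integral_neg]
  simp only [← integral_mul_const]
  have hgeom : Summable fun k : ℕ => |w| * (r * |w|) ^ k :=
    (summable_geometric_of_lt_one (by positivity) hrw).mul_left _
  refine hasSum_integral_of_dominated_convergence (fun k _ => |w| * (r * |w|) ^ k)
    (fun k => by fun_prop) (fun k => ?_) (Eventually.of_forall fun _ => hgeom)
    (integrable_const _) ?_
  · filter_upwards [hN] with l hl
    rw [Real.norm_eq_abs, abs_mul, abs_pow, abs_pow, abs_of_nonneg hl.1, pow_succ, mul_pow]
    have : l ^ k ≤ r ^ k := pow_le_pow_left₀ hl.1 hl.2 k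
    calc l ^ k * (|w| ^ k * |w|) ≤ r ^ k * (|w| ^ k * |w|) := by gcongr
      _ = _ := by ring
  · filter_upwards [hN] with l hl
    have hlw : |l * w| < 1 := by
      rw [abs_mul, abs_of_nonneg hl.1]
      exact lt_of_le_of_lt (by gcongr; exact hl.2) hrw
    have h := (hasSum_geometric_of_abs_lt_one hlw).mul_left w
    have hne : 1 - l * w ≠ 0 := by
      have := (abs_lt.mp hlw).2
      linarith
    have hne' : l - w⁻¹ ≠ 0 := by
      intro h0
      apply hne
      rw [sub_eq_zero.mp h0, inv_mul_cancel₀ hw, sub_self]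
    have hval : w * (1 - l * w)⁻¹ = -(l - w⁻¹)⁻¹ := by
      have h1 : l - w⁻¹ = -((1 - l * w) / w) := by field_simp; ring
      rw [h1, inv_neg, neg_neg, inv_div, div_eq_mul_inv]
    rw [hval] at h
    refine h.congr_fun fun k => ?_
    ring

/-- On the negative half-line the functional equation determines the Stieltjes transform. -/
lemma integral_inv_sub_eq_exp_sub_one {N : Measure ℝ} (hN : ∀ᵐ l ∂N, 0 ≤ l)
    (heq : ∀ z ∈ cutPlane,
      (1 + stieltjesTransform N z) * Complex.log (1 + stieltjesTransform N z) = -z⁻¹)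
    {s : ℝ} (hs : 0 < s) :
    ∫ l : ℝ, (l - (-(s * Real.exp s))⁻¹)⁻¹ ∂N = Real.exp s - 1 := by
  set z : ℝ := (-(s * Real.exp s))⁻¹ with hz
  have hz0 : z < 0 := by
    rw [hz, inv_lt_zero, neg_lt_zero]
    positivity
  set g : ℝ := ∫ l : ℝ, (l - z)⁻¹ ∂N
  have hg : 0 ≤ g := by
    refine integral_nonneg_of_ae ?_
    filter_upwards [hN] with l hl
    exact inv_nonneg.mpr (by linarith)
  have hst : stieltjesTransform N (z : ℂ) = (g : ℂ) := by
    rw [stieltjesTransform, show (g : ℂ) = ∫ l : ℝ, (((l - z)⁻¹ : ℝ) : ℂ) ∂N from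
      integral_ofReal.symm]
    simp
  have h := heq z (Or.inr (by simpa using hz0))
  have hcast : (1 : ℂ) + g = ((1 + g : ℝ) : ℂ) := by push_cast; rfl
  rw [hst, hcast, ← Complex.ofReal_log (by linarith)] at h
  have hreal : (1 + g) * Real.log (1 + g) = s * Real.exp s := by
    have h' : (1 + g) * Real.log (1 + g) = -z⁻¹ := by exact_mod_cast h
    rw [h', hz, inv_inv, neg_neg]
  have hu : 0 ≤ Real.log (1 + g) := Real.log_nonneg (by linarith)
  have hexp : Real.exp (Real.log (1 + g)) = 1 + g := Real.exp_log (by linarith)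
  have hus : Real.log (1 + g) = s := by
    rcases lt_trichotomy (Real.log (1 + g)) s with hlt | heq' | hgt
    · have := mul_lt_mul'' hlt (Real.exp_lt_exp.mpr hlt) hu (Real.exp_pos _).le
      rw [hexp] at this
      linarith
    · exact heq'
    · have := mul_lt_mul'' hgt (Real.exp_lt_exp.mpr hgt) hs.le (Real.exp_pos _).le
      rw [hexp] at this
      linarith
  rw [hus] at hexp
  linarith

/-- Theorem 1.4(iv): the moments of the probability measure `N` supported
on `[0, e]` whose Stieltjes transform satisfies `(1 + f)Log(1 + f) = −1/z` are
`μ_k = k^k/(k+1)!` for every `k ≥ 1`. -/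
theorem triangular_moments
    (N : Measure ℝ) [IsProbabilityMeasure N]
    (hsupp : N (Set.Icc 0 (Real.exp 1))ᶜ = 0)
    (heq : ∀ z ∈ cutPlane,
      (1 + stieltjesTransform N z) * Complex.log (1 + stieltjesTransform N z) = -z⁻¹) :
    ∀ k : ℕ, 1 ≤ k →
      ∫ l : ℝ, l ^ k ∂N = (k : ℝ) ^ k / (Nat.factorial (k + 1) : ℝ) := by
  have hN : ∀ᵐ l ∂N, l ∈ Set.Icc 0 (Real.exp 1) := hsupp
  have hmoment : ∀ k : ℕ, |∫ l : ℝ, l ^ k ∂N| ≤ Real.exp 1 ^ k := by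
    intro k
    have h := norm_integral_le_of_norm_le_const (μ := N) (f := fun l : ℝ => l ^ k)
      (C := Real.exp 1 ^ k) (by
        filter_upwards [hN] with l hl
        rw [Real.norm_eq_abs, abs_pow, abs_of_nonneg hl.1]
        exact pow_le_pow_left₀ hl.1 hl.2 k)
    simpa using h
  have hcoeff : ∀ k : ℕ, |(k : ℝ) ^ k / ((k + 1).factorial : ℝ)| ≤ Real.exp 1 ^ k := by
    intro k
    rw [abs_of_nonneg (by positivity)]
    exact pow_self_div_factorial_succ_le_exp_pow k
  have htend : Tendsto (fun s : ℝ => -(s * Real.exp s)) (nhdsWithin 0 (Set.Ioi 0))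
      (nhdsWithin 0 {0}ᶜ) := by
    refine tendsto_nhdsWithin_iff.mpr ⟨?_, ?_⟩
    · have hc : Continuous fun s : ℝ => -(s * Real.exp s) := by fun_prop
      simpa using (hc.tendsto 0).mono_left nhdsWithin_le_nhds
    · filter_upwards [self_mem_nhdsWithin] with s hs
      have : 0 < s * Real.exp s := mul_pos hs (Real.exp_pos s)
      simpa using this.ne'
  have hsmall : ∀ᶠ s : ℝ in nhdsWithin 0 (Set.Ioi 0), Real.exp 1 * (s * Real.exp s) < 1 := by
    have hc : Continuous fun s : ℝ => Real.exp 1 * (s * Real.exp s) := by fun_prop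
    exact nhdsWithin_le_nhds (hc.continuousAt.eventually_lt_const (by simp))
  have hagree : ∀ᶠ s : ℝ in nhdsWithin 0 (Set.Ioi 0),
      ∑' k : ℕ, (∫ l : ℝ, l ^ k ∂N) * (-(s * Real.exp s)) ^ k
        = ∑' k : ℕ, (k : ℝ) ^ k / ((k + 1).factorial : ℝ) * (-(s * Real.exp s)) ^ k := by
    filter_upwards [hsmall, self_mem_nhdsWithin] with s hs' hs
    have hpos : 0 < s * Real.exp s := mul_pos hs (Real.exp_pos s)
    have hne : -(s * Real.exp s) ≠ 0 := neg_ne_zero.mpr hpos.ne'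
    have h₁ := hasSum_moment_mul_pow hN hne (by rwa [abs_neg, abs_of_pos hpos])
      (Real.exp_pos 1).le
    rw [integral_inv_sub_eq_exp_sub_one (hN.mono fun l hl => hl.1) heq hs, neg_sub] at h₁
    have h₂ := h₁.tsum_eq.trans (hasSum_pow_self_div_factorial_mul_pow hs hs').tsum_eq.symm
    simp only [pow_succ, ← mul_assoc, tsum_mul_right] at h₂
    exact mul_right_cancel₀ hne h₂
  have heqcoeff := eq_of_frequently_tsum_mul_pow_eq (Real.exp_pos 1) hmoment hcoeff
    (htend.frequently hagree.frequently)
  exact fun k _ => congrFun heqcoeff k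
end

section
/- Let ν > 0 and let v : ℝ → ℝ be a piecewise continuous function, and set u(t) = ∫_{−ν}^{ν} v²(t − τ) dτ and w² = ∫_{−ν}^{ν} v²(s) ds. (a) If v² restricted to [−2ν, 2ν] coincides with the restriction of a 2ν-periodic locally integrable function, then u(t) = w² for all t ∈ [−ν, ν]. (b) Conversely, if v² is continuous on [−2ν, 2ν] and u(t) = w² for all t ∈ [−ν, ν], then v²(s + 2ν) = v²(s) for all s ∈ [−2ν, 0], i.e., v²|_{[−2ν,2ν]} is the restriction of a 2ν-periodic function. -/
open MeasureTheory Filter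

/-- A moving average of a continuous function is differentiable, with derivative the difference
of the endpoint values. -/
theorem hasDerivAt_integral_sub_add {g : ℝ → ℝ} (hg : Continuous g) (a t : ℝ) :
    HasDerivAt (fun t => ∫ s in (t - a)..(t + a), g s) (g (t + a) - g (t - a)) t := by
  have primitive (b : ℝ) : HasDerivAt (fun x => ∫ s in (0 : ℝ)..x, g s) (g b) b :=
    intervalIntegral.integral_hasDerivAt_right (hg.intervalIntegrable _ _)
      (hg.stronglyMeasurableAtFilter _ _) hg.continuousAt
  have hsub := ((primitive (t + a)).comp_add_const t a).sub ((primitive (t - a)).comp_sub_const t a)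
  refine hsub.congr_of_eventuallyEq (Eventually.of_forall fun x => ?_)
  exact (intervalIntegral.integral_interval_sub_left (hg.intervalIntegrable _ _)
    (hg.intervalIntegrable _ _)).symm

/-- If the moving average of radius `a` of a continuous function is constant on a nondegenerate
closed interval, the endpoint values agree throughout that interval. -/
theorem eq_of_integral_sub_add_const {g : ℝ → ℝ} (hg : Continuous g) {a b c C : ℝ} (hbc : b < c)
    (h : ∀ t ∈ Set.Icc b c, (∫ s in (t - a)..(t + a), g s) = C) {t : ℝ} (ht : t ∈ Set.Icc b c) :
    g (t + a) = g (t - a) :=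
  sub_eq_zero.mp <| (uniqueDiffOn_Icc hbc t ht).eq_deriv _
    (hasDerivAt_integral_sub_add hg a t).hasDerivWithinAt
    ((hasDerivWithinAt_const t _ C).congr h (h t ht))

/-- The convolution of `f` with the indicator of `[-a, a]` is a moving average of `f`. -/
theorem integral_comp_sub_left_symm (f : ℝ → ℝ) (a t : ℝ) :
    (∫ τ in (-a)..a, f (t - τ)) = ∫ s in (t - a)..(t + a), f s := by
  rw [intervalIntegral.integral_comp_sub_left, sub_neg_eq_add]

/-- For `t ∈ [-a, a]`, the interval of radius `a` around `t` lies in `[-2a, 2a]`. -/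
theorem uIcc_sub_add_subset {a t : ℝ} (ht : t ∈ Set.Icc (-a) a) :
    Set.uIcc (t - a) (t + a) ⊆ Set.Icc (-(2 * a)) (2 * a) := by
  obtain ⟨h₁, h₂⟩ := ht
  rw [Set.uIcc_of_le (by linarith)]
  exact Set.Icc_subset_Icc (by linarith) (by linarith)

/-- constancy of the convolution `u(t) = ∫_{-ν}^{ν} v²(t−τ)dτ` on
`[−ν,ν]` is equivalent to `2ν`-periodicity of `v²` on `[−2ν,2ν]`:
(a) if `v²` agrees on `[−2ν,2ν]` with a `2ν`-periodic locally integrable function then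
`u ≡ w²` on `[−ν,ν]`; (b) conversely, if `v²` is continuous on `[−2ν,2ν]` and `u ≡ w²` on
`[−ν,ν]`, then `v²(s + 2ν) = v²(s)` for all `s ∈ [−2ν,0]`. -/
theorem convolution_constant_iff_periodic
    (ν : ℝ) (hν : 0 < ν)
    (v : ℝ → ℝ) (hvmeas : Measurable v)
    (S : Set ℝ) (hS : S.Finite) (hv : ContinuousOn v Sᶜ) :
    -- (a)
    (∀ p : ℝ → ℝ, Function.Periodic p (2 * ν) → LocallyIntegrable p volume →
      (∀ s ∈ Set.Icc (-(2 * ν)) (2 * ν), v s ^ 2 = p s) →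
      ∀ t ∈ Set.Icc (-ν) ν,
        (∫ τ in (-ν)..ν, v (t - τ) ^ 2) = ∫ s in (-ν)..ν, v s ^ 2) ∧
    -- (b)
    (ContinuousOn (fun s => v s ^ 2) (Set.Icc (-(2 * ν)) (2 * ν)) →
      (∀ t ∈ Set.Icc (-ν) ν,
        (∫ τ in (-ν)..ν, v (t - τ) ^ 2) = ∫ s in (-ν)..ν, v s ^ 2) →
      ∀ s ∈ Set.Icc (-(2 * ν)) 0, v (s + 2 * ν) ^ 2 = v s ^ 2) := by
  constructor
  · intro p hp _ hvp t ht
    have hcongr {x : ℝ} (hx : x ∈ Set.Icc (-ν) ν) :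
        (∫ s in (x - ν)..(x + ν), v s ^ 2) = ∫ s in (x - ν)..(x + ν), p s :=
      intervalIntegral.integral_congr fun s hs => hvp s (uIcc_sub_add_subset hx hs)
    have hzero := hcongr (x := 0) ⟨by linarith, hν.le⟩
    rw [zero_sub, zero_add] at hzero
    rw [integral_comp_sub_left_symm (fun s => v s ^ 2), hcongr ht, hzero]
    have hperiod := hp.intervalIntegral_add_eq (t - ν) (-ν)
    rwa [show t - ν + 2 * ν = t + ν by ring, show -ν + 2 * ν = ν by ring] at hperiod
  · intro hcont hconst s hs
    have hle : -(2 * ν) ≤ 2 * ν := by linarith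
    set g : ℝ → ℝ := Set.IccExtend hle ((Set.Icc (-(2 * ν)) (2 * ν)).domRestrict fun s => v s ^ 2)
    have hg : Continuous g := hcont.domRestrict.Icc_extend'
    have hgv {x : ℝ} (hx : x ∈ Set.Icc (-(2 * ν)) (2 * ν)) : g x = v x ^ 2 :=
      Set.IccExtend_of_mem hle _ hx
    have havg : ∀ t ∈ Set.Icc (-ν) ν,
        (∫ x in (t - ν)..(t + ν), g x) = ∫ x in (-ν)..ν, v x ^ 2 := fun t ht => by
      rw [← hconst t ht, integral_comp_sub_left_symm (fun s => v s ^ 2)]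
      exact intervalIntegral.integral_congr fun x hx => hgv (uIcc_sub_add_subset ht hx)
    obtain ⟨hs₁, hs₂⟩ := hs
    have heq := eq_of_integral_sub_add_const hg (neg_lt_self hν) havg
      (t := s + ν) ⟨by linarith, by linarith⟩
    rw [add_sub_cancel_right, add_assoc, ← two_mul] at heq
    rwa [hgv ⟨by linarith, by linarith⟩, hgv ⟨hs₁, by linarith⟩] at heq
end

section
/- Let x > 0 and let φ : [−1/2, 1/2] → ℝ be twice continuously differentiable with 1 + φ(t) > 0 for all t, satisfying the differential equation φ''(t)·(1 + φ(t)) = φ'(t)² on [−1/2, 1/2] together with the boundary conditions φ(1/2) = 0 and φ'(−1/2) = −1/x. Then F := φ(−1/2) satisfies (1 + F)·ln(1 + F) = 1/x. -/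
open Set Filter

/-- A function whose derivative within a convex set of reals vanishes is constant there. -/
theorem eq_of_hasDerivWithinAt_zero {s : Set ℝ} (hs : Convex ℝ s) {g : ℝ → ℝ}
    (hg : ∀ t ∈ s, HasDerivWithinAt g 0 s t) {a t : ℝ} (ha : a ∈ s) (ht : t ∈ s) :
    g t = g a := by
  have h := hs.norm_image_sub_le_of_norm_hasDerivWithin_le (C := 0) hg (by simp) ha ht
  rw [zero_mul, norm_le_zero_iff] at h
  exact sub_eq_zero.mp h

/-- If `u > 0` solves `u'' u = (u')²` on a convex set of reals, then `log u` is affine there. -/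
theorem log_eq_affine_of_mul_eq_sq {s : Set ℝ} (hs : Convex ℝ s) {u u' u'' : ℝ → ℝ}
    (hu : ∀ t ∈ s, HasDerivWithinAt u (u' t) s t)
    (hu' : ∀ t ∈ s, HasDerivWithinAt u' (u'' t) s t)
    (hpos : ∀ t ∈ s, 0 < u t) (hode : ∀ t ∈ s, u'' t * u t = u' t ^ 2)
    {a t : ℝ} (ha : a ∈ s) (ht : t ∈ s) :
    Real.log (u t) = Real.log (u a) + u' a / u a * (t - a) := by
  have hslope : ∀ r ∈ s, u' r / u r = u' a / u a := fun r hr =>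
    eq_of_hasDerivWithinAt_zero hs (g := fun r => u' r / u r) (fun r hr => by
      have h := (hu' r hr).fun_div (hu r hr) (hpos r hr).ne'
      rwa [hode r hr, sq, sub_self, zero_div] at h) ha hr
  have hconst := eq_of_hasDerivWithinAt_zero hs
    (g := fun r => Real.log (u r) - u' a / u a * r) (fun r hr => by
      have h := ((hu r hr).log (hpos r hr).ne').fun_sub
        ((hasDerivWithinAt_id r s).const_mul (u' a / u a))
      rwa [hslope r hr, mul_one, sub_self] at h) ha ht
  linarith

/-- the ODE reduction (4.1)–(4.3) at `z = −x < 0`: if `φ` is twice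
continuously differentiable on `[−1/2, 1/2]` with `1 + φ > 0`, satisfies
`φ''(1 + φ) = (φ')²` with `φ(1/2) = 0` and `φ'(−1/2) = −1/x`, then `F = φ(−1/2)` satisfies
`(1 + F)·ln(1 + F) = 1/x`. -/
theorem triangular_ode_reduction
    (x : ℝ) (hx : 0 < x)
    (φ φ' φ'' : ℝ → ℝ)
    (hd1 : ∀ t ∈ Icc (-(1 : ℝ)/2) (1/2),
      HasDerivWithinAt φ (φ' t) (Icc (-(1 : ℝ)/2) (1/2)) t)
    (hd2 : ∀ t ∈ Icc (-(1 : ℝ)/2) (1/2),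
      HasDerivWithinAt φ' (φ'' t) (Icc (-(1 : ℝ)/2) (1/2)) t)
    (hcont : ContinuousOn φ'' (Icc (-(1 : ℝ)/2) (1/2)))
    (hpos : ∀ t ∈ Icc (-(1 : ℝ)/2) (1/2), 0 < 1 + φ t)
    (hode : ∀ t ∈ Icc (-(1 : ℝ)/2) (1/2), φ'' t * (1 + φ t) = (φ' t) ^ 2)
    (hbc1 : φ (1/2) = 0)
    (hbc2 : φ' (-(1 : ℝ)/2) = -1/x) :
    (1 + φ (-(1 : ℝ)/2)) * Real.log (1 + φ (-(1 : ℝ)/2)) = 1/x := by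
  have ha : -(1 : ℝ)/2 ∈ Icc (-(1 : ℝ)/2) (1/2) := by constructor <;> norm_num
  have hb : (1 : ℝ)/2 ∈ Icc (-(1 : ℝ)/2) (1/2) := by constructor <;> norm_num
  have h := log_eq_affine_of_mul_eq_sq (convex_Icc _ _) (u := fun t => 1 + φ t)
    (fun t ht => (hd1 t ht).const_add 1) hd2 hpos hode ha hb
  have hF := hpos _ ha
  simp only [hbc1, hbc2, add_zero, Real.log_one] at h
  have hlog : Real.log (1 + φ (-(1 : ℝ)/2)) = 1 / x / (1 + φ (-(1 : ℝ)/2)) := by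
    linear_combination -h
  rw [hlog, mul_div_cancel₀ _ hF.ne']
end

section
/- The function x(f) = −1/((1 + f)·ln(1 + f)), defined for f > −1, f ≠ 0, is strictly increasing on the interval [e^{−1} − 1, 0), where it maps [e^{−1} − 1, 0) bijectively onto [e, ∞), and strictly increasing on (0, ∞), where it maps (0, ∞) bijectively onto (−∞, 0). Consequently ℝ∖x(L) has closure [0, e], where L = [e^{−1} − 1, 0) ∪ (0, ∞). -/
open Set Filter

/-- The functional inverse `x(f) = −1/((1+f)·ln(1+f))` of the Stieltjes transform of the
limiting singular value distribution of lower triangular matrices. -/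
noncomputable def invStieltjes (f : ℝ) : ℝ := -((1 + f) * Real.log (1 + f))⁻¹

open Real in
/-- `u ↦ u log u` is strictly increasing to the right of its minimum point `e⁻¹`. -/
theorem strictMonoOn_mul_log_Ici : StrictMonoOn (fun u : ℝ => u * log u) (Ici (exp (-1))) := by
  refine strictMonoOn_of_deriv_pos (convex_Ici _) continuous_mul_log.continuousOn fun u hu => ?_
  rw [interior_Ici, mem_Ioi] at hu
  have hu0 : 0 < u := (exp_pos _).trans hu
  rw [deriv_mul_log hu0.ne']
  linarith [(lt_log_iff_exp_lt hu0).2 hu]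

open Real in
theorem exists_mul_log_eq {y : ℝ} (hy : -exp (-1) ≤ y) : ∃ u ∈ Ici (exp (-1)), u * log u = y := by
  have h1 : exp (-1) ≤ exp 1 := exp_le_exp.2 (by norm_num)
  have hle : exp (-1) ≤ exp 1 + |y| := by linarith [abs_nonneg y]
  have hlog : 1 ≤ log (exp 1 + |y|) :=
    (le_log_iff_exp_le (by positivity)).2 (by linarith [abs_nonneg y])
  have hbig : y ≤ (exp 1 + |y|) * log (exp 1 + |y|) := by
    nlinarith [le_abs_self y, exp_pos 1, abs_nonneg y]
  obtain ⟨u, hu, huy⟩ := intermediate_value_Icc hle continuous_mul_log.continuousOn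
    (show y ∈ Icc _ _ from ⟨by simpa using hy, hbig⟩)
  exact ⟨u, hu.1, huy⟩

theorem strictMonoOn_invStieltjes_Ico :
    StrictMonoOn invStieltjes (Ico (Real.exp (-1) - 1) 0) := by
  intro a ha b hb hab
  have hpos := Real.exp_pos (-1)
  have h : (1 + a) * Real.log (1 + a) < (1 + b) * Real.log (1 + b) :=
    strictMonoOn_mul_log_Ici (mem_Ici.2 (by linarith [ha.1])) (mem_Ici.2 (by linarith [hb.1]))
      (by linarith)
  have hb0 : (1 + b) * Real.log (1 + b) < 0 :=
    mul_neg_of_pos_of_neg (by linarith [hb.1]) (Real.log_neg (by linarith [hb.1])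
      (by linarith [hb.2]))
  exact neg_lt_neg ((inv_lt_inv_of_neg hb0 (h.trans hb0)).2 h)

theorem strictMonoOn_invStieltjes_Ioi : StrictMonoOn invStieltjes (Ioi 0) := by
  intro a ha b hb hab
  rw [mem_Ioi] at ha hb
  have hlt : Real.exp (-1) < 1 := Real.exp_lt_one_iff.2 (by norm_num)
  have h : (1 + a) * Real.log (1 + a) < (1 + b) * Real.log (1 + b) :=
    strictMonoOn_mul_log_Ici (mem_Ici.2 (by linarith)) (mem_Ici.2 (by linarith)) (by linarith)
  have ha0 : 0 < (1 + a) * Real.log (1 + a) :=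
    mul_pos (by linarith) (Real.log_pos (by linarith))
  exact neg_lt_neg ((inv_lt_inv₀ (ha0.trans h) ha0).2 h)

theorem invStieltjes_exp_neg_one_sub_one : invStieltjes (Real.exp (-1) - 1) = Real.exp 1 := by
  simp [invStieltjes, Real.exp_neg]

theorem image_invStieltjes_Ico :
    invStieltjes '' Ico (Real.exp (-1) - 1) 0 = Ici (Real.exp 1) := by
  have hlt : Real.exp (-1) < 1 := Real.exp_lt_one_iff.2 (by norm_num)
  ext x
  constructor
  · rintro ⟨f, hf, rfl⟩
    rw [mem_Ici, ← invStieltjes_exp_neg_one_sub_one]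
    exact strictMonoOn_invStieltjes_Ico.monotoneOn ⟨le_rfl, by linarith⟩ hf hf.1
  · intro hx
    have hx0 : 0 < x := (Real.exp_pos 1).trans_le hx
    obtain ⟨u, hu, hux⟩ := exists_mul_log_eq (y := -x⁻¹)
      (by rw [Real.exp_neg]; exact neg_le_neg (inv_anti₀ (Real.exp_pos 1) hx))
    refine ⟨u - 1, ⟨by linarith [mem_Ici.1 hu], ?_⟩, by simp [invStieltjes, hux]⟩
    by_contra! h
    have : 0 ≤ u * Real.log u := mul_nonneg (by linarith) (Real.log_nonneg (by linarith))
    linarith [inv_pos.2 hx0]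

theorem image_invStieltjes_Ioi : invStieltjes '' Ioi 0 = Iio 0 := by
  ext x
  constructor
  · rintro ⟨f, hf, rfl⟩
    rw [mem_Ioi] at hf
    exact neg_neg_of_pos (inv_pos.2 (mul_pos (by linarith) (Real.log_pos (by linarith))))
  · intro hx
    have hx0 : 0 < -x⁻¹ := neg_pos.2 (inv_lt_zero.2 hx)
    obtain ⟨u, hu, hux⟩ := exists_mul_log_eq (y := -x⁻¹) (by linarith [Real.exp_pos (-1)])
    refine ⟨u - 1, ?_, by simp [invStieltjes, hux]⟩
    by_contra h
    have hu0 : 0 ≤ u := (Real.exp_pos _).le.trans hu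
    have hu1 : u ≤ 1 := by simpa using h
    linarith [mul_nonpos_of_nonneg_of_nonpos hu0 (Real.log_nonpos hu0 hu1)]

/-- `x(f) = −1/((1+f)ln(1+f))` is strictly increasing on
`[e⁻¹ − 1, 0)`, mapping it bijectively onto `[e, ∞)`, and strictly increasing on `(0, ∞)`,
mapping it bijectively onto `(−∞, 0)`; consequently the closure of `ℝ∖x(L)`, where
`L = [e⁻¹ − 1, 0) ∪ (0, ∞)`, is `[0, e]`. -/
theorem invStieltjes_monotonicity_and_support :
    StrictMonoOn invStieltjes (Ico (Real.exp (-1) - 1) 0) ∧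
    invStieltjes '' Ico (Real.exp (-1) - 1) 0 = Ici (Real.exp 1) ∧
    StrictMonoOn invStieltjes (Ioi 0) ∧
    invStieltjes '' Ioi 0 = Iio 0 ∧
    closure (univ \ invStieltjes '' (Ico (Real.exp (-1) - 1) 0 ∪ Ioi 0))
      = Icc 0 (Real.exp 1) := by
  refine ⟨strictMonoOn_invStieltjes_Ico, image_invStieltjes_Ico, strictMonoOn_invStieltjes_Ioi,
    image_invStieltjes_Ioi, ?_⟩
  rw [image_union, image_invStieltjes_Ico, image_invStieltjes_Ioi, ← compl_eq_univ_sdiff,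
    compl_union, compl_Ici, compl_Iio, inter_comm, Ici_inter_Iio,
    closure_Ico (Real.exp_pos 1).ne]
end

section
/- For η ∈ (0, π) define λ(η) = e^{η·cot η}·(sin η)/η and c(η) = −η·cot η + iη. Then: (i) c(η)·e^{c(η)} = −1/λ(η); (ii) Im(e^{c(η)} − 1) = sin²η/(λ(η)·η); (iii) λ is a continuous strictly decreasing bijection from (0, π) onto (0, e), with λ(η) → e as η → 0⁺ and λ(η) → 0 as η → π⁻. -/
open Set Filter Real Complex

/-- `λ(η) = e^{η·cot η}·(sin η)/η`. -/
noncomputable def lambdaParam (η : ℝ) : ℝ :=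
  Real.exp (η * Real.cos η / Real.sin η) * Real.sin η / η

/-- `c(η) = −η·cot η + iη`. -/
noncomputable def cParam (η : ℝ) : ℂ :=
  (↑(-(η * Real.cos η / Real.sin η)) : ℂ) + (η : ℂ) * Complex.I

theorem lambdaParam_pos {η : ℝ} (hη : η ∈ Ioo 0 Real.pi) : 0 < lambdaParam η :=
  div_pos (mul_pos (Real.exp_pos _) (Real.sin_pos_of_mem_Ioo hη)) hη.1

theorem hasDerivAt_lambdaParam {η : ℝ} (hη : η ∈ Ioo 0 Real.pi) :
    HasDerivAt lambdaParam (-lambdaParam η *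
      ((η - Real.sin η * Real.cos η) ^ 2 + Real.sin η ^ 4) / (Real.sin η ^ 2 * η)) η := by
  have hs : Real.sin η ≠ 0 := (Real.sin_pos_of_mem_Ioo hη).ne'
  have h0 : η ≠ 0 := hη.1.ne'
  have h := (((((hasDerivAt_id η).mul (Real.hasDerivAt_cos η)).div
    (Real.hasDerivAt_sin η) hs).exp).mul (Real.hasDerivAt_sin η)).div (hasDerivAt_id η) h0
  refine HasDerivAt.congr_deriv (f := lambdaParam) h ?_
  have h4 : Real.sin η ^ 4 = Real.sin η ^ 2 * (1 - Real.cos η ^ 2) := by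
    rw [← Real.sin_sq]; ring
  rw [h4]
  simp only [lambdaParam, id, Pi.mul_apply, Pi.div_apply]
  field_simp
  linear_combination (-η ^ 2) * Real.sin_sq_add_cos_sq η

theorem continuousOn_lambdaParam : ContinuousOn lambdaParam (Ioo 0 Real.pi) :=
  fun _ hη => (hasDerivAt_lambdaParam hη).continuousAt.continuousWithinAt

theorem strictAntiOn_lambdaParam : StrictAntiOn lambdaParam (Ioo 0 Real.pi) := by
  refine strictAntiOn_of_deriv_neg (convex_Ioo _ _) continuousOn_lambdaParam fun η hη => ?_
  rw [interior_Ioo] at hη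
  have hs := Real.sin_pos_of_mem_Ioo hη
  have hl := lambdaParam_pos hη
  have h0 := hη.1
  rw [(hasDerivAt_lambdaParam hη).deriv, neg_mul, neg_div]
  exact neg_neg_of_pos (by positivity)

theorem tendsto_lambdaParam_zero :
    Tendsto lambdaParam (nhdsWithin 0 (Ioi 0)) (nhds (Real.exp 1)) := by
  have hc : ContinuousAt (fun η => Real.exp (Real.cos η / Real.sinc η) * Real.sinc η) 0 := by
    have h1 : Real.sinc 0 ≠ 0 := by simp
    have h2 := Real.continuous_sinc.continuousAt (x := 0)
    exact (Real.continuous_exp.continuousAt.comp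
      (Real.continuous_cos.continuousAt.div h2 h1)).mul h2
  have ht := hc.tendsto.mono_left (nhdsWithin_le_nhds (s := Ioi 0))
  simp only [Real.cos_zero, Real.sinc_zero, div_one, mul_one] at ht
  refine ht.congr' ?_
  filter_upwards [self_mem_nhdsWithin] with η hη
  have h0 : η ≠ 0 := ne_of_gt hη
  rw [Real.sinc_of_ne_zero h0, lambdaParam, mul_div_assoc, div_div_eq_mul_div, mul_comm η]

theorem tendsto_lambdaParam_pi :
    Tendsto lambdaParam (nhdsWithin Real.pi (Iio Real.pi)) (nhds 0) := by
  have hc : Tendsto (fun η => Real.sin η / η) (nhdsWithin Real.pi (Iio Real.pi)) (nhds 0) := by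
    have h : ContinuousAt (fun η => Real.sin η / η) Real.pi :=
      Real.continuous_sin.continuousAt.div continuousAt_id Real.pi_ne_zero
    simpa using h.tendsto.mono_left (nhdsWithin_le_nhds (s := Iio Real.pi))
  have hmem : Ioo (Real.pi / 2) Real.pi ∈ nhdsWithin Real.pi (Iio Real.pi) :=
    Ioo_mem_nhdsLT (half_lt_self Real.pi_pos)
  have hsub : ∀ η ∈ Ioo (Real.pi / 2) Real.pi, η ∈ Ioo 0 Real.pi :=
    fun η hη => ⟨Real.pi_div_two_pos.trans hη.1, hη.2⟩
  refine tendsto_of_tendsto_of_tendsto_of_le_of_le' tendsto_const_nhds hc ?_ ?_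
  · filter_upwards [hmem] with η hη using (lambdaParam_pos (hsub η hη)).le
  · filter_upwards [hmem] with η hη
    have h0 : 0 < η := (hsub η hη).1
    have hs := Real.sin_pos_of_mem_Ioo (hsub η hη)
    have hcos : Real.cos η ≤ 0 :=
      Real.cos_nonpos_of_pi_div_two_le_of_le hη.1.le (by linarith [hη.2, Real.pi_pos])
    have he : Real.exp (η * Real.cos η / Real.sin η) ≤ 1 :=
      Real.exp_le_one_iff.2
        (div_nonpos_of_nonpos_of_nonneg (mul_nonpos_of_nonneg_of_nonpos h0.le hcos) hs.le)
    rw [lambdaParam, mul_div_assoc]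
    exact mul_le_of_le_one_left (by positivity) he

theorem lambdaParam_lt_exp_one {η : ℝ} (hη : η ∈ Ioo 0 Real.pi) :
    lambdaParam η < Real.exp 1 := by
  have h2 : η / 2 ∈ Ioo 0 Real.pi := ⟨half_pos hη.1, (half_lt_self hη.1).trans hη.2⟩
  refine (strictAntiOn_lambdaParam h2 hη (half_lt_self hη.1)).trans_le ?_
  refine ge_of_tendsto tendsto_lambdaParam_zero ?_
  filter_upwards [Ioo_mem_nhdsGT h2.1] with x hx
  exact (strictAntiOn_lambdaParam ⟨hx.1, hx.2.trans h2.2⟩ h2 hx.2).le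

theorem image_lambdaParam : lambdaParam '' Ioo 0 Real.pi = Ioo 0 (Real.exp 1) := by
  refine Subset.antisymm ?_ ?_
  · rintro _ ⟨η, hη, rfl⟩
    exact ⟨lambdaParam_pos hη, lambdaParam_lt_exp_one hη⟩
  · exact isPreconnected_Ioo.intermediate_value_Ioo
      (le_principal_iff.2 (Ioo_mem_nhdsLT Real.pi_pos))
      (le_principal_iff.2 (Ioo_mem_nhdsGT Real.pi_pos))
      continuousOn_lambdaParam tendsto_lambdaParam_pi tendsto_lambdaParam_zero

theorem exp_cParam (η : ℝ) :
    Complex.exp (cParam η) = (Real.exp (η * Real.cos η / Real.sin η) : ℂ)⁻¹ *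
      (Real.cos η + Real.sin η * Complex.I) := by
  rw [cParam, Complex.exp_add, Complex.exp_mul_I, ← Complex.ofReal_exp, Real.exp_neg]
  push_cast
  rfl

theorem cParam_mul_exp_cParam {η : ℝ} (hη : η ∈ Ioo 0 Real.pi) :
    cParam η * Complex.exp (cParam η) = -(1 / (lambdaParam η : ℂ)) := by
  have hs : (Real.sin η : ℂ) ≠ 0 :=
    Complex.ofReal_ne_zero.2 (Real.sin_pos_of_mem_Ioo hη).ne'
  have h0 : (η : ℂ) ≠ 0 := Complex.ofReal_ne_zero.2 hη.1.ne'
  have he : (Real.exp (η * Real.cos η / Real.sin η) : ℂ) ≠ 0 :=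
    Complex.ofReal_ne_zero.2 (Real.exp_pos _).ne'
  have hsq : (Real.sin η : ℂ) ^ 2 + (Real.cos η : ℂ) ^ 2 = 1 := by
    exact_mod_cast Real.sin_sq_add_cos_sq η
  rw [exp_cParam, cParam, lambdaParam, Complex.ofReal_div, Complex.ofReal_mul,
    Complex.ofReal_neg, Complex.ofReal_div, Complex.ofReal_mul]
  generalize (Real.exp (η * Real.cos η / Real.sin η) : ℂ) = E at *
  generalize (Real.sin η : ℂ) = s at *
  generalize (Real.cos η : ℂ) = k at *
  field_simp
  linear_combination s ^ 2 * Complex.I_sq - hsq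

theorem im_exp_cParam_sub_one {η : ℝ} (hη : η ∈ Ioo 0 Real.pi) :
    (Complex.exp (cParam η) - 1).im = Real.sin η ^ 2 / (lambdaParam η * η) := by
  have hs : Real.sin η ≠ 0 := (Real.sin_pos_of_mem_Ioo hη).ne'
  have h0 : η ≠ 0 := hη.1.ne'
  rw [Complex.sub_im, Complex.one_im, sub_zero, exp_cParam, ← Complex.ofReal_inv,
    Complex.im_ofReal_mul, lambdaParam, Complex.add_im, Complex.ofReal_im,
    Complex.im_ofReal_mul, Complex.I_im]
  field_simp
  ring

/-- the boundary parametrization (4.6): for `η ∈ (0,π)`,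
(i) `c(η)e^{c(η)} = −1/λ(η)`; (ii) `Im(e^{c(η)} − 1) = sin²η/(λ(η)η)`; (iii) `λ` is a
continuous strictly decreasing bijection from `(0,π)` onto `(0,e)` with `λ(0⁺) = e`,
`λ(π⁻) = 0`. -/
theorem triangular_boundary_parametrization :
    (∀ η ∈ Ioo 0 Real.pi,
      cParam η * Complex.exp (cParam η) = -(1 / (lambdaParam η : ℂ))) ∧
    (∀ η ∈ Ioo 0 Real.pi,
      (Complex.exp (cParam η) - 1).im = Real.sin η ^ 2 / (lambdaParam η * η)) ∧
    ContinuousOn lambdaParam (Ioo 0 Real.pi) ∧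
    StrictAntiOn lambdaParam (Ioo 0 Real.pi) ∧
    lambdaParam '' Ioo 0 Real.pi = Ioo 0 (Real.exp 1) ∧
    Tendsto lambdaParam (nhdsWithin 0 (Ioi 0)) (nhds (Real.exp 1)) ∧
    Tendsto lambdaParam (nhdsWithin Real.pi (Iio Real.pi)) (nhds 0) := by
  exact ⟨fun _ hη => cParam_mul_exp_cParam hη, fun _ hη => im_exp_cParam_sub_one hη,
    continuousOn_lambdaParam, strictAntiOn_lambdaParam, image_lambdaParam,
    tendsto_lambdaParam_zero, tendsto_lambdaParam_pi⟩
end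

section
/- Let x₀ ∈ (0, 1) and suppose F : (0, x₀) → (0, ∞) satisfies (1 + F(x))·ln(1 + F(x)) = 1/x for all x ∈ (0, x₀). Then lim_{x→0⁺} F(x)·x·ln(1/x) = 1, i.e., F(x) = (1 + o(1))/(x·ln(1/x)) as x ↓ 0. -/
open Set Filter

/-- The rescaled solution of `u * log u = y`, written in terms of `t = log u`, tends to `1`. -/
lemma tendsto_one_sub_exp_neg_mul_one_add_log_div :
    Tendsto (fun t : ℝ => (1 - Real.exp (-t)) * (1 + Real.log t / t)) atTop (nhds 1) := by
  have hexp : Tendsto (fun t : ℝ => Real.exp (-t)) atTop (nhds 0) :=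
    Real.tendsto_exp_neg_atTop_nhds_zero
  have hlog : Tendsto (fun t : ℝ => Real.log t / t) atTop (nhds 0) :=
    Real.isLittleO_log_id_atTop.tendsto_div_nhds_zero
  simpa using (hexp.const_sub 1).mul (hlog.const_add 1)

/-- asymptotics (4.5): if `F : (0,x₀) → (0,∞)` satisfies
`(1 + F(x))·ln(1 + F(x)) = 1/x`, then `F(x)·x·ln(1/x) → 1` as `x ↓ 0`, i.e.
`F(x) = (1 + o(1))/(x ln(1/x))`. -/
theorem triangular_stieltjes_asymptotics_at_zero
    (x₀ : ℝ) (hx₀ : x₀ ∈ Ioo (0 : ℝ) 1) (F : ℝ → ℝ)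
    (hFpos : ∀ x ∈ Ioo 0 x₀, 0 < F x)
    (hFeq : ∀ x ∈ Ioo 0 x₀, (1 + F x) * Real.log (1 + F x) = 1 / x) :
    Tendsto (fun x => F x * x * Real.log (1 / x)) (nhdsWithin 0 (Ioi 0)) (nhds 1) := by
  have hmem : ∀ᶠ x in nhdsWithin (0 : ℝ) (Ioi 0), x ∈ Ioo 0 x₀ := Ioo_mem_nhdsGT hx₀.1
  have hLpos : ∀ x ∈ Ioo 0 x₀, 0 < Real.log (1 + F x) := fun x hx =>
    Real.log_pos (by linarith [hFpos x hx])
  have hlog : ∀ x ∈ Ioo 0 x₀,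
      Real.log (1 / x) = Real.log (1 + F x) + Real.log (Real.log (1 + F x)) := fun x hx => by
    rw [← hFeq x hx, Real.log_mul (by linarith [hFpos x hx]) (hLpos x hx).ne']
  have hinv : Tendsto (fun x : ℝ => Real.log (1 / x) / 2) (nhdsWithin 0 (Ioi 0)) atTop := by
    simp only [one_div]
    exact (Real.tendsto_log_atTop.comp tendsto_inv_nhdsGT_zero).atTop_div_const two_pos
  have hL : Tendsto (fun x => Real.log (1 + F x)) (nhdsWithin 0 (Ioi 0)) atTop := by
    refine tendsto_atTop_mono' _ ?_ hinv
    filter_upwards [hmem] with x hx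
    linarith [hlog x hx, Real.log_le_self (hLpos x hx).le]
  refine (tendsto_one_sub_exp_neg_mul_one_add_log_div.comp hL).congr' ?_
  filter_upwards [hmem] with x hx
  have hu : 0 < 1 + F x := by linarith [hFpos x hx]
  have hLx := hLpos x hx
  have hFx : F x * x = F x / ((1 + F x) * Real.log (1 + F x)) := by
    rw [hFeq x hx, div_div_eq_mul_div, div_one]
  rw [hlog x hx, hFx, Function.comp_apply, Real.exp_neg, Real.exp_log hu]
  field_simp
  ring
end
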